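/- arXiv:2403.13738 — 7 statements merged into one kernel-verified Lean document; each statement's English description precedes it below -/
import Mathlib

section
/- Under Assumption 1, the following conditional-moment equalities hold ℙ-almost surely: E[Y·D | σ(Z)] = ∫ m_1(v, X)·m_D(v, Z) dv; E[Y·(1−D) | σ(Z)] = ∫ m_0(v, X)·(1 − m_D(v, Z)) dv; and E[D | σ(Z)] = ∫ m_D(v, Z) dv, where σ(Z) is the σ-algebra generated by Z and each integral is over v ∈ [0,1]^K with respect to Lebesgue measure. -/
open MeasureTheory ProbabilityTheory

/-- If `V` and `Z` are independent, then conditioning `g (V, Z)` on `Z` amounts to integrating out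
the first variable against the law of `V`. -/
theorem condExp_comp_ae_eq_integral_map_of_indepFun {Ω α β : Type*} [MeasurableSpace Ω]
    {P : Measure Ω} [IsFiniteMeasure P] [MeasurableSpace α] [StandardBorelSpace α] [Nonempty α]
    [mβ : MeasurableSpace β] {V : Ω → α} {Z : Ω → β} (hV : Measurable V) (hZ : Measurable Z)
    (hVZ : IndepFun V Z P) {g : α → β → ℝ} (hg : Measurable (Function.uncurry g))
    (hint : Integrable (fun ω => g (V ω) (Z ω)) P) :
    P[fun ω => g (V ω) (Z ω) | mβ.comap Z] =ᵐ[P] fun ω => ∫ v, g v (Z ω) ∂(P.map V) := by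
  have hcond : condDistrib V Z P =ᵐ[P.map Z] Kernel.const β (P.map V) := by
    refine condDistrib_ae_eq_of_measure_eq_compProd Z hV.aemeasurable ?_
    rw [Measure.compProd_const]
    exact (indepFun_iff_map_prod_eq_prod_map_map hZ.aemeasurable hV.aemeasurable).1 hVZ.symm
  have hg' : StronglyMeasurable fun p : β × α => g p.2 p.1 :=
    (hg.comp measurable_swap).stronglyMeasurable
  filter_upwards [condExp_prod_ae_eq_integral_condDistrib hZ hV.aemeasurable hg' hint,
    ae_of_ae_map hZ.aemeasurable hcond] with ω h₁ h₂
  rw [h₁, h₂, Kernel.const_apply]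

/-- If the conditional expectation of `Y` given `(D, Z, V)` is `m (V, Z)` and that of the bounded
function `w D` given `(V, Z)` is `q (V, Z)`, with `V` and `Z` independent, then the conditional
expectation of `Y * w D` given `Z` is the integral of `m * q` against the law of `V`. -/
theorem condExp_mul_ae_eq_integral_mul_of_indepFun {Ω α β : Type*} [mΩ : MeasurableSpace Ω]
    {P : Measure Ω} [IsFiniteMeasure P] [MeasurableSpace α] [StandardBorelSpace α]
    [Nonempty α] [mβ : MeasurableSpace β] {V : Ω → α} {Z : Ω → β} {D Y : Ω → ℝ} {w : ℝ → ℝ}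
    (hV : Measurable V) (hZ : Measurable Z) (hD : Measurable D) (hw : Measurable w) {C : ℝ}
    (hwC : ∀ ω, ‖w (D ω)‖ ≤ C) (hY : Integrable Y P) (hVZ : IndepFun V Z P) {m q : α → β → ℝ}
    (hm : Measurable (Function.uncurry m)) (hq : Measurable (Function.uncurry q))
    (hmY : P[Y | MeasurableSpace.comap (fun ω => (D ω, Z ω, V ω)) inferInstance]
      =ᵐ[P] fun ω => m (V ω) (Z ω))
    (hqD : P[fun ω => w (D ω) | MeasurableSpace.comap (fun ω => (V ω, Z ω)) inferInstance]
      =ᵐ[P] fun ω => q (V ω) (Z ω)) :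
    P[fun ω => Y ω * w (D ω) | mβ.comap Z]
      =ᵐ[P] fun ω => ∫ v, m v (Z ω) * q v (Z ω) ∂(P.map V) := by
  have hwm : AEStronglyMeasurable (fun ω => w (D ω)) P :=
    (hw.comp hD).aestronglyMeasurable
  have hw_int : Integrable (fun ω => w (D ω)) P := .of_bound hwm C (.of_forall hwC)
  have hYw_int : Integrable (Y * fun ω => w (D ω)) P := hY.mul_bdd hwm (.of_forall hwC)
  have hm_int : Integrable (fun ω => m (V ω) (Z ω)) P := integrable_condExp.congr hmY
  have hmw_int : Integrable ((fun ω => m (V ω) (Z ω)) * fun ω => w (D ω)) P :=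
    hm_int.mul_bdd hwm (.of_forall hwC)
  have hmq := condExp_comp_ae_eq_integral_map_of_indepFun hV hZ hVZ
    (g := fun v z => m v z * q v z) (hm.mul hq)
  let 𝓕 : MeasurableSpace Ω := MeasurableSpace.comap (fun ω => (D ω, Z ω, V ω)) inferInstance
  let 𝓖 : MeasurableSpace Ω := MeasurableSpace.comap (fun ω => (V ω, Z ω)) inferInstance
  have h𝓕_le : 𝓕 ≤ mΩ := (hD.prodMk (hZ.prodMk hV)).comap_le
  have h𝓖_le : 𝓖 ≤ mΩ := (hV.prodMk hZ).comap_le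
  have hVZ_meas : Measurable[𝓖] fun ω => (V ω, Z ω) := comap_measurable _
  have hDZV_meas : Measurable[𝓕] fun ω => (D ω, Z ω, V ω) := comap_measurable _
  have h𝓖𝓕 : 𝓖 ≤ 𝓕 := by
    have : Measurable[𝓕] fun ω => (V ω, Z ω) :=
      ((measurable_snd.comp measurable_snd).prodMk
        (measurable_fst.comp measurable_snd)).comp hDZV_meas
    exact this.comap_le
  have hZ𝓖 : mβ.comap Z ≤ 𝓖 := (measurable_snd.comp hVZ_meas).comap_le
  have hw𝓕 : StronglyMeasurable[𝓕] fun ω => w (D ω) :=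
    ((hw.comp measurable_fst).comp hDZV_meas).stronglyMeasurable
  have hm𝓖 : StronglyMeasurable[𝓖] fun ω => m (V ω) (Z ω) :=
    (hm.comp hVZ_meas).stronglyMeasurable
  have h₁ : P[Y * fun ω => w (D ω) | 𝓕] =ᵐ[P] (fun ω => m (V ω) (Z ω)) * fun ω => w (D ω) :=
    (condExp_mul_of_stronglyMeasurable_right hw𝓕 hYw_int hY).trans (hmY.mul .rfl)
  have h₂ : P[Y * fun ω => w (D ω) | 𝓖] =ᵐ[P] fun ω => m (V ω) (Z ω) * q (V ω) (Z ω) :=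
    (condExp_condExp_of_le h𝓖𝓕 h𝓕_le).symm.trans <| (condExp_congr_ae h₁).trans <|
      (condExp_mul_of_stronglyMeasurable_left hm𝓖 hmw_int hw_int).trans
        (Filter.EventuallyEq.rfl.mul hqD)
  exact (condExp_condExp_of_le hZ𝓖 h𝓖_le).symm.trans <| (condExp_congr_ae h₂).trans <|
    hmq (integrable_condExp.congr h₂)

/-- Theorem 1 of the paper: under Assumption 1, the conditional moment equalities
`E[YD | σ(Z)] = ∫ m₁(v,X) m_D(v,Z) dv`, `E[Y(1-D) | σ(Z)] = ∫ m₀(v,X)(1-m_D(v,Z)) dv`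
and `E[D | σ(Z)] = ∫ m_D(v,Z) dv` hold almost surely. -/
theorem stmt_0
    {Ω : Type*} [MeasurableSpace Ω] (P : Measure Ω) [IsProbabilityMeasure P]
    {𝓩 𝓧 : Type*} [MeasurableSpace 𝓩] [StandardBorelSpace 𝓩]
    [MeasurableSpace 𝓧] [StandardBorelSpace 𝓧]
    (x : 𝓩 → 𝓧) (hx : Measurable x)
    (Z : Ω → 𝓩) (hZ : Measurable Z)
    (K : ℕ) (hK : 1 ≤ K)
    (V : Ω → (Fin K → ℝ)) (hV : Measurable V)
    (D : Ω → ℝ) (hD : Measurable D) (hD01 : ∀ ω, D ω = 0 ∨ D ω = 1)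
    (Y0 Y1 : Ω → ℝ) (hY0 : Measurable Y0) (hY1 : Measurable Y1)
    (yL yU : ℝ) (hy : yL ≤ yU)
    (hbd0 : ∀ ω, Y0 ω ∈ Set.Icc yL yU) (hbd1 : ∀ ω, Y1 ω ∈ Set.Icc yL yU)
    -- Assumption 1 (i)
    (hA10 : P[Y0 | MeasurableSpace.comap (fun ω => (D ω, Z ω, V ω)) inferInstance]
        =ᵐ[P] P[Y0 | MeasurableSpace.comap (fun ω => (x (Z ω), V ω)) inferInstance])
    (hA11 : P[Y1 | MeasurableSpace.comap (fun ω => (D ω, Z ω, V ω)) inferInstance]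
        =ᵐ[P] P[Y1 | MeasurableSpace.comap (fun ω => (x (Z ω), V ω)) inferInstance])
    -- Assumption 1 (ii)
    (hVZ : IndepFun V Z P)
    (hVunif : Measure.map V P = volume.restrict (Set.Icc (0 : Fin K → ℝ) 1))
    -- the marginal treatment response functions and the propensity score
    (m0 m1 : (Fin K → ℝ) → 𝓧 → ℝ) (mD : (Fin K → ℝ) → 𝓩 → ℝ)
    (hm0 : Measurable (Function.uncurry m0))
    (hm1 : Measurable (Function.uncurry m1))
    (hmD : Measurable (Function.uncurry mD))
    (hm0v : P[Y0 | MeasurableSpace.comap (fun ω => (V ω, x (Z ω))) inferInstance]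
        =ᵐ[P] fun ω => m0 (V ω) (x (Z ω)))
    (hm1v : P[Y1 | MeasurableSpace.comap (fun ω => (V ω, x (Z ω))) inferInstance]
        =ᵐ[P] fun ω => m1 (V ω) (x (Z ω)))
    (hmDv : P[D | MeasurableSpace.comap (fun ω => (V ω, Z ω)) inferInstance]
        =ᵐ[P] fun ω => mD (V ω) (Z ω)) :
    (P[fun ω => (D ω * Y1 ω + (1 - D ω) * Y0 ω) * D ω | MeasurableSpace.comap Z inferInstance]
        =ᵐ[P] fun ω => ∫ v in Set.Icc (0 : Fin K → ℝ) 1, m1 v (x (Z ω)) * mD v (Z ω)) ∧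
    (P[fun ω => (D ω * Y1 ω + (1 - D ω) * Y0 ω) * (1 - D ω) |
        MeasurableSpace.comap Z inferInstance]
        =ᵐ[P] fun ω => ∫ v in Set.Icc (0 : Fin K → ℝ) 1, m0 v (x (Z ω)) * (1 - mD v (Z ω))) ∧
    (P[D | MeasurableSpace.comap Z inferInstance]
        =ᵐ[P] fun ω => ∫ v in Set.Icc (0 : Fin K → ℝ) 1, mD v (Z ω)) := by
  have hswap : MeasurableSpace.comap (fun ω => (x (Z ω), V ω)) inferInstance
      = MeasurableSpace.comap (fun ω => (V ω, x (Z ω))) inferInstance :=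
    le_antisymm (measurable_swap.comp (comap_measurable fun ω => (V ω, x (Z ω)))).comap_le
      (measurable_swap.comp (comap_measurable fun ω => (x (Z ω), V ω))).comap_le
  rw [hswap] at hA10 hA11
  have hVZ_le := (hV.prodMk hZ).comap_le
  have hint {W : Ω → ℝ} (hW : Measurable W) {a b : ℝ} (hab : ∀ ω, W ω ∈ Set.Icc a b) :
      Integrable W P := .of_mem_Icc a b hW.aemeasurable (.of_forall hab)
  have hxm {m : (Fin K → ℝ) → 𝓧 → ℝ} (hm : Measurable (Function.uncurry m)) :
      Measurable (Function.uncurry fun v z => m v (x z)) :=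
    hm.comp (measurable_fst.prodMk (hx.comp measurable_snd))
  have hD_int : Integrable D P := hint hD (a := 0) (b := 1) fun ω => by
    rcases hD01 ω with h | h <;> simp [h]
  have hD_compl : P[fun ω => 1 - D ω | MeasurableSpace.comap (fun ω => (V ω, Z ω)) inferInstance]
      =ᵐ[P] fun ω => 1 - mD (V ω) (Z ω) := by
    have h := condExp_sub (integrable_const (1 : ℝ)) hD_int
      (MeasurableSpace.comap (fun ω => (V ω, Z ω)) inferInstance)
    rw [condExp_const hVZ_le] at h
    exact h.trans (Filter.EventuallyEq.rfl.sub hmDv)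
  have hYD : (fun ω => (D ω * Y1 ω + (1 - D ω) * Y0 ω) * D ω) = fun ω => Y1 ω * D ω := by
    ext ω; rcases hD01 ω with h | h <;> simp [h]
  have hYD' : (fun ω => (D ω * Y1 ω + (1 - D ω) * Y0 ω) * (1 - D ω))
      = fun ω => Y0 ω * (1 - D ω) := by
    ext ω; rcases hD01 ω with h | h <;> simp [h]
  rw [hYD, hYD', ← hVunif]
  refine ⟨?_, ?_, ?_⟩
  · exact condExp_mul_ae_eq_integral_mul_of_indepFun (w := fun d => d) (C := 1) hV hZ hD
      measurable_id (fun ω => by rcases hD01 ω with h | h <;> simp [h]) (hint hY1 hbd1) hVZ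
      (hxm hm1) hmD (hA11.trans hm1v) hmDv
  · exact condExp_mul_ae_eq_integral_mul_of_indepFun (w := fun d => 1 - d)
      (q := fun v z => 1 - mD v z) (C := 1) hV hZ hD (measurable_const.sub measurable_id)
      (fun ω => by rcases hD01 ω with h | h <;> simp [h]) (hint hY0 hbd0) hVZ
      (hxm hm0) (measurable_const.sub hmD) (hA10.trans hm0v) hD_compl
  · have hZ_le : MeasurableSpace.comap Z inferInstance
        ≤ MeasurableSpace.comap (fun ω => (V ω, Z ω)) inferInstance :=
      (measurable_snd.comp (comap_measurable fun ω => (V ω, Z ω))).comap_le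
    exact (condExp_condExp_of_le hZ_le hVZ_le).symm.trans <| (condExp_congr_ae hmDv).trans <|
      condExp_comp_ae_eq_integral_map_of_indepFun hV hZ hVZ hmD (integrable_condExp.congr hmDv)
end

section
/- For every feasible m ∈ ℳ, the cell-averaged quintuple Λm — defined on each cell 𝒱_k by Λm_•(v, ·) = λ(𝒱_k)^{-1}·∫_{𝒱_k} m_•(u, ·) du for v ∈ 𝒱_k, where λ is Lebesgue measure — belongs to ℳ, is a constant spline, is feasible, and satisfies Γ*(Λm) = Γ*(m). Consequently inf{Γ*(m) : m ∈ ℳ feasible} = inf{Γ*(m) : m ∈ ℳ feasible and a constant spline} and sup{Γ*(m) : m ∈ ℳ feasible} = sup{Γ*(m) : m ∈ ℳ feasible and a constant spline}. -/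
open MeasureTheory ProbabilityTheory

/-- A quintuple `m = (m₀, m₁, m_D, m₀D, m₁D)` of marginal treatment response functions and
propensity scores. -/
structure Quint (α 𝓧 𝓩 : Type*) where
  m0 : α → 𝓧 → ℝ
  m1 : α → 𝓧 → ℝ
  mD : α → 𝓩 → ℝ
  m0D : α → 𝓩 → ℝ
  m1D : α → 𝓩 → ℝ

/-- Membership in `ℳ`: measurable components with values in the required intervals on the
cube `C`. -/
def InM {α 𝓧 𝓩 : Type*} [MeasurableSpace α] [MeasurableSpace 𝓧] [MeasurableSpace 𝓩]
    (C : Set α) (yL yU : ℝ) (m : Quint α 𝓧 𝓩) : Prop :=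
  Measurable (Function.uncurry m.m0) ∧ Measurable (Function.uncurry m.m1) ∧
  Measurable (Function.uncurry m.mD) ∧ Measurable (Function.uncurry m.m0D) ∧
  Measurable (Function.uncurry m.m1D) ∧
  (∀ v ∈ C, ∀ ξ, m.m0 v ξ ∈ Set.Icc yL yU) ∧ (∀ v ∈ C, ∀ ξ, m.m1 v ξ ∈ Set.Icc yL yU) ∧
  (∀ v ∈ C, ∀ z, m.mD v z ∈ Set.Icc (0 : ℝ) 1) ∧
  (∀ v ∈ C, ∀ z, m.m0D v z ∈ Set.Icc yL yU) ∧ (∀ v ∈ C, ∀ z, m.m1D v z ∈ Set.Icc yL yU)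

/-- The moment constraints associated with an IV-like function `s`. -/
def MomentOK {Ω α 𝓧 𝓩 : Type*} [MeasurableSpace Ω] [MeasurableSpace α] [MeasurableSpace 𝓩]
    (P : Measure Ω) (Z : Ω → 𝓩) (D Y : Ω → ℝ) (ν : Measure α)
    (m : Quint α 𝓧 𝓩) (s : 𝓩 → ℝ) : Prop :=
  ((∫ ω, Y ω * D ω * s (Z ω) ∂P) = ∫ ω, s (Z ω) * ∫ v, m.m1D v (Z ω) ∂ν ∂P) ∧
  ((∫ ω, Y ω * (1 - D ω) * s (Z ω) ∂P) = ∫ ω, s (Z ω) * ∫ v, m.m0D v (Z ω) ∂ν ∂P) ∧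
  ((∫ ω, D ω * s (Z ω) ∂P) = ∫ ω, s (Z ω) * ∫ v, m.mD v (Z ω) ∂ν ∂P)

/-- The McCormick constraints with (possibly `v`-dependent) bound functions, a.e. with
respect to a measure `μ` on pairs `(v, z)`. -/
def McCormickOK {α 𝓧 𝓩 : Type*} (x : 𝓩 → 𝓧) [MeasurableSpace α] [MeasurableSpace 𝓩]
    (μ : Measure (α × 𝓩)) (m : Quint α 𝓧 𝓩)
    (b0L b0U b1L b1U : α → 𝓧 → ℝ) (bDL bDU : α → 𝓩 → ℝ) : Prop :=
  ∀ᵐ p ∂μ,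
    (b0L p.1 (x p.2) ≤ m.m0 p.1 (x p.2) ∧ m.m0 p.1 (x p.2) ≤ b0U p.1 (x p.2)) ∧
    (b1L p.1 (x p.2) ≤ m.m1 p.1 (x p.2) ∧ m.m1 p.1 (x p.2) ≤ b1U p.1 (x p.2)) ∧
    (bDL p.1 p.2 ≤ m.mD p.1 p.2 ∧ m.mD p.1 p.2 ≤ bDU p.1 p.2) ∧
    (m.m0D p.1 p.2 ≥ b0L p.1 (x p.2) * (1 - m.mD p.1 p.2)
        + m.m0 p.1 (x p.2) * (1 - bDU p.1 p.2) - b0L p.1 (x p.2) * (1 - bDU p.1 p.2)) ∧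
    (m.m0D p.1 p.2 ≥ b0U p.1 (x p.2) * (1 - m.mD p.1 p.2)
        + m.m0 p.1 (x p.2) * (1 - bDL p.1 p.2) - b0U p.1 (x p.2) * (1 - bDL p.1 p.2)) ∧
    (m.m0D p.1 p.2 ≤ b0U p.1 (x p.2) * (1 - m.mD p.1 p.2)
        + m.m0 p.1 (x p.2) * (1 - bDU p.1 p.2) - b0U p.1 (x p.2) * (1 - bDU p.1 p.2)) ∧
    (m.m0D p.1 p.2 ≤ b0L p.1 (x p.2) * (1 - m.mD p.1 p.2)
        + m.m0 p.1 (x p.2) * (1 - bDL p.1 p.2) - b0L p.1 (x p.2) * (1 - bDL p.1 p.2)) ∧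
    (m.m1D p.1 p.2 ≥ b1L p.1 (x p.2) * m.mD p.1 p.2
        + m.m1 p.1 (x p.2) * bDL p.1 p.2 - b1L p.1 (x p.2) * bDL p.1 p.2) ∧
    (m.m1D p.1 p.2 ≥ b1U p.1 (x p.2) * m.mD p.1 p.2
        + m.m1 p.1 (x p.2) * bDU p.1 p.2 - b1U p.1 (x p.2) * bDU p.1 p.2) ∧
    (m.m1D p.1 p.2 ≤ b1U p.1 (x p.2) * m.mD p.1 p.2
        + m.m1 p.1 (x p.2) * bDL p.1 p.2 - b1U p.1 (x p.2) * bDL p.1 p.2) ∧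
    (m.m1D p.1 p.2 ≤ b1L p.1 (x p.2) * m.mD p.1 p.2
        + m.m1 p.1 (x p.2) * bDU p.1 p.2 - b1L p.1 (x p.2) * bDU p.1 p.2)

/-- The target parameter `Γ*` with (possibly `v`-dependent) weight functions. -/
noncomputable def GammaStar {Ω α 𝓧 𝓩 : Type*} [MeasurableSpace Ω] [MeasurableSpace α]
    (P : Measure Ω) (Z : Ω → 𝓩) (x : 𝓩 → 𝓧) (ν : Measure α)
    (ω00 ω01 ω10 ω11 : α → 𝓩 → ℝ) (m : Quint α 𝓧 𝓩) : ℝ :=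
  ∫ ω, ∫ v, (m.m0D v (Z ω) * ω00 v (Z ω)
      + (m.m0 v (x (Z ω)) - m.m0D v (Z ω)) * ω01 v (Z ω)
      + (m.m1 v (x (Z ω)) - m.m1D v (Z ω)) * ω10 v (Z ω)
      + m.m1D v (Z ω) * ω11 v (Z ω)) ∂ν ∂P

/-- The cell average of a function over the partition `{𝒱_k}`: on the cell `𝒱_k` it equals
`λ(𝒱_k)⁻¹ ∫_{𝒱_k} f(u, ·) du`. -/
noncomputable def cellAvg {K KV : ℕ} (𝒱 : Fin KV → Set (Fin K → ℝ)) {β : Type*}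
    (f : (Fin K → ℝ) → β → ℝ) : (Fin K → ℝ) → β → ℝ :=
  fun v b => ∑ k : Fin KV,
    Set.indicator (𝒱 k) (fun _ => (volume (𝒱 k)).toReal⁻¹ * ∫ u in 𝒱 k, f u b) v

/-- The cell-averaged quintuple `Λm`. -/
noncomputable def LamQ {K KV : ℕ} {𝓧 𝓩 : Type*} (𝒱 : Fin KV → Set (Fin K → ℝ))
    (m : Quint (Fin K → ℝ) 𝓧 𝓩) : Quint (Fin K → ℝ) 𝓧 𝓩 where
  m0 := cellAvg 𝒱 m.m0
  m1 := cellAvg 𝒱 m.m1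
  mD := cellAvg 𝒱 m.mD
  m0D := cellAvg 𝒱 m.m0D
  m1D := cellAvg 𝒱 m.m1D

/-- `m` is a constant spline: each component is constant in `v` on each cell `𝒱_k`, for
each value of its second argument in the relevant finite support. -/
def ConstSpline {K KV KZ : ℕ} {𝓧 𝓩 : Type*} (𝒱 : Fin KV → Set (Fin K → ℝ))
    (zs : Fin KZ → 𝓩) (x : 𝓩 → 𝓧) (m : Quint (Fin K → ℝ) 𝓧 𝓩) : Prop :=
  ∀ k : Fin KV, ∀ v ∈ 𝒱 k, ∀ v' ∈ 𝒱 k, ∀ l : Fin KZ,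
    m.m0 v (x (zs l)) = m.m0 v' (x (zs l)) ∧ m.m1 v (x (zs l)) = m.m1 v' (x (zs l)) ∧
    m.mD v (zs l) = m.mD v' (zs l) ∧ m.m0D v (zs l) = m.m0D v' (zs l) ∧
    m.m1D v (zs l) = m.m1D v' (zs l)

open Set

section CellAverage

variable {K KV : ℕ} {𝒱 : Fin KV → Set (Fin K → ℝ)} {β : Type*}

/-- On each cell, the cell average is the mean under the uniform law of that cell. -/
lemma cellAvg_eq_integral_cond
    (hVdisj : Pairwise (Function.onFun Disjoint 𝒱)) (f : (Fin K → ℝ) → β → ℝ)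
    {k : Fin KV} {v : Fin K → ℝ} (hv : v ∈ 𝒱 k) (b : β) :
    cellAvg 𝒱 f v b = ∫ u, f u b ∂volume[|𝒱 k] := by
  unfold cellAvg
  rw [Finset.sum_eq_single k]
  · rw [indicator_of_mem hv, ProbabilityTheory.cond, integral_smul_measure, ENNReal.toReal_inv,
      smul_eq_mul]
  · intro j _ hj
    exact indicator_of_notMem (fun h => (hVdisj hj).le_bot ⟨h, hv⟩) _
  · simp

lemma measurable_cellAvg [MeasurableSpace β] (hVmeas : ∀ k, MeasurableSet (𝒱 k))
    {f : (Fin K → ℝ) → β → ℝ} (hf : Measurable (Function.uncurry f)) :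
    Measurable (Function.uncurry (cellAvg 𝒱 f)) := by
  have key : ∀ k, Measurable fun b => ∫ u in 𝒱 k, f u b := fun k =>
    (hf.stronglyMeasurable.integral_prod_left (μ := volume.restrict (𝒱 k))).measurable
  unfold cellAvg Function.uncurry
  refine Finset.measurable_sum _ fun k _ => ?_
  have : (fun p : (Fin K → ℝ) × β => indicator (𝒱 k)
      (fun _ => (volume (𝒱 k)).toReal⁻¹ * ∫ u in 𝒱 k, f u p.2) p.1) =
      indicator (Prod.fst ⁻¹' 𝒱 k)
        (fun p => (volume (𝒱 k)).toReal⁻¹ * ∫ u in 𝒱 k, f u p.2) := by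
    ext p
    rfl
  rw [this]
  exact (((key k).comp measurable_snd).const_mul _).indicator (measurable_fst (hVmeas k))

/-- A measurable function taking values in a compact interval on the finite-measure set `C`
remains integrable there after multiplication by a bounded measurable weight. -/
lemma integrableOn_mul_of_mem_Icc [MeasurableSpace β] {C : Set (Fin K → ℝ)}
    (hC : MeasurableSet C) (hCfin : volume C ≠ ⊤) {f : (Fin K → ℝ) → β → ℝ}
    (hf : Measurable (Function.uncurry f)) {a c : ℝ} (hfI : ∀ v ∈ C, ∀ b, f v b ∈ Icc a c)
    {w : (Fin K → ℝ) → ℝ} (hw : Measurable w) {M : ℝ} (hM : ∀ v, |w v| ≤ M) (b : β) :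
    IntegrableOn (fun v => f v b * w v) C := by
  refine Measure.integrableOn_of_bounded (M := max |a| |c| * M) hCfin
    ((hf.of_uncurry_right.mul hw).aestronglyMeasurable) ?_
  filter_upwards [ae_restrict_mem hC] with v hv
  rw [Real.norm_eq_abs, abs_mul]
  exact mul_le_mul (abs_le_max_abs_abs (hfI v hv b).1 (hfI v hv b).2) (hM v) (abs_nonneg _)
    (le_max_of_le_left (abs_nonneg _))

lemma integrableOn_of_mem_Icc [MeasurableSpace β] {C : Set (Fin K → ℝ)}
    (hC : MeasurableSet C) (hCfin : volume C ≠ ⊤) {f : (Fin K → ℝ) → β → ℝ}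
    (hf : Measurable (Function.uncurry f)) {a c : ℝ} (hfI : ∀ v ∈ C, ∀ b, f v b ∈ Icc a c)
    (b : β) : IntegrableOn (fun v => f v b) C := by
  simpa using integrableOn_mul_of_mem_Icc hC hCfin hf hfI (w := fun _ => 1) measurable_const
    (M := 1) (by simp) b

lemma integrable_cond_of_integrableOn {α : Type*} [MeasurableSpace α] {μ : Measure α}
    {s t : Set α} {g : α → ℝ} (hs : μ s ≠ 0) (hst : s ⊆ t) (hg : IntegrableOn g t μ) :
    Integrable g (cond μ s) :=
  (hg.mono_set hst).smul_measure (ENNReal.inv_ne_top.2 hs)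

/-- Affine inequalities are inherited by means. -/
lemma affine_integral_nonneg {α : Type*} [MeasurableSpace α] {μ : Measure α}
    [IsProbabilityMeasure μ] {f g h : α → ℝ} (hf : Integrable f μ) (hg : Integrable g μ)
    (hh : Integrable h μ) (a b c d : ℝ)
    (hnn : ∀ᵐ u ∂μ, 0 ≤ a + b * f u + c * g u + d * h u) :
    0 ≤ a + b * ∫ u, f u ∂μ + c * ∫ u, g u ∂μ + d * ∫ u, h u ∂μ := by
  have h1 := integral_nonneg_of_ae hnn
  have hab : Integrable (fun u => a + b * f u) μ := (integrable_const a).add (hf.const_mul b)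
  have habc : Integrable (fun u => a + b * f u + c * g u) μ := hab.add (hg.const_mul c)
  rwa [integral_add habc (hh.const_mul d), integral_add hab (hg.const_mul c), integral_add (integrable_const a) (hf.const_mul b),
    integral_const_mul, integral_const_mul, integral_const_mul, integral_const,
    probReal_univ, one_smul] at h1

lemma mem_Icc_integral {α : Type*} [MeasurableSpace α] {μ : Measure α}
    [IsProbabilityMeasure μ] {f : α → ℝ} (hf : Integrable f μ) {a c : ℝ}
    (h : ∀ᵐ u ∂μ, f u ∈ Icc a c) : ∫ u, f u ∂μ ∈ Icc a c :=
  (convex_Icc a c).integral_mem isClosed_Icc h hf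

variable {C : Set (Fin K → ℝ)}

lemma cellAvg_mem_Icc [MeasurableSpace β] (hVmeas : ∀ k, MeasurableSet (𝒱 k))
    (hVpos : ∀ k, 0 < volume (𝒱 k)) (hVdisj : Pairwise (Function.onFun Disjoint 𝒱))
    (hVcover : (⋃ k, 𝒱 k) = C) (hCfin : volume C ≠ ⊤) {f : (Fin K → ℝ) → β → ℝ}
    (hf : Measurable (Function.uncurry f)) {a c : ℝ} (hfI : ∀ v ∈ C, ∀ b, f v b ∈ Icc a c) :
    ∀ v ∈ C, ∀ b, cellAvg 𝒱 f v b ∈ Icc a c := by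
  intro v hv b
  have hC : MeasurableSet C := hVcover ▸ MeasurableSet.iUnion hVmeas
  obtain ⟨k, hk⟩ := mem_iUnion.1 (hVcover ▸ hv)
  have hsub : 𝒱 k ⊆ C := hVcover ▸ subset_iUnion 𝒱 k
  have : IsProbabilityMeasure volume[|𝒱 k] :=
    cond_isProbabilityMeasure_of_finite (hVpos k).ne' (measure_ne_top_of_subset hsub hCfin)
  rw [cellAvg_eq_integral_cond hVdisj f hk b]
  refine mem_Icc_integral (integrable_cond_of_integrableOn (hVpos k).ne' hsub
    (integrableOn_of_mem_Icc hC hCfin hf hfI b)) ?_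
  filter_upwards [ae_cond_mem (hVmeas k)] with u hu using hfI u (hsub hu) b

/-- Cell averaging preserves integrals against weights that are constant on cells. -/
lemma integral_cellAvg_mul [MeasurableSpace β] (hVmeas : ∀ k, MeasurableSet (𝒱 k))
    (hVpos : ∀ k, 0 < volume (𝒱 k)) (hVdisj : Pairwise (Function.onFun Disjoint 𝒱))
    (hVcover : (⋃ k, 𝒱 k) = C) (hCfin : volume C ≠ ⊤) {f : (Fin K → ℝ) → β → ℝ}
    (hf : Measurable (Function.uncurry f)) {a c : ℝ} (hfI : ∀ v ∈ C, ∀ b, f v b ∈ Icc a c)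
    {w : (Fin K → ℝ) → ℝ} (hw : Measurable w) {M : ℝ} (hM : ∀ v, |w v| ≤ M)
    (hconst : ∀ k, ∀ v ∈ 𝒱 k, ∀ v' ∈ 𝒱 k, w v = w v') (b : β) :
    ∫ v in C, cellAvg 𝒱 f v b * w v = ∫ v in C, f v b * w v := by
  have hC : MeasurableSet C := hVcover ▸ MeasurableSet.iUnion hVmeas
  have h1 := integrableOn_mul_of_mem_Icc hC hCfin hf hfI hw hM b
  have h2 := integrableOn_mul_of_mem_Icc hC hCfin (measurable_cellAvg hVmeas hf)
    (cellAvg_mem_Icc hVmeas hVpos hVdisj hVcover hCfin hf hfI) hw hM b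
  have hsub : ∀ k, 𝒱 k ⊆ C := fun k => hVcover ▸ subset_iUnion 𝒱 k
  rw [← hVcover, integral_iUnion_fintype hVmeas hVdisj fun k => h2.mono_set (hsub k),
    integral_iUnion_fintype hVmeas hVdisj fun k => h1.mono_set (hsub k)]
  refine Finset.sum_congr rfl fun k _ => ?_
  obtain ⟨v₀, hv₀⟩ := nonempty_of_measure_ne_zero (hVpos k).ne'
  have hne : (volume (𝒱 k)).toReal ≠ 0 :=
    (ENNReal.toReal_pos (hVpos k).ne' (measure_ne_top_of_subset (hsub k) hCfin)).ne'
  rw [setIntegral_congr_fun (g := fun _ => cellAvg 𝒱 f v₀ b * w v₀) (hVmeas k)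
      fun v hv => by
        simp only [cellAvg_eq_integral_cond hVdisj f hv,
          cellAvg_eq_integral_cond hVdisj f hv₀, hconst k v hv v₀ hv₀],
    setIntegral_congr_fun (f := fun v => f v b * w v) (g := fun v => f v b * w v₀) (hVmeas k)
      fun v hv => by simp only [hconst k v hv v₀ hv₀],
    setIntegral_const, integral_mul_const,
    cellAvg_eq_integral_cond hVdisj f hv₀, ProbabilityTheory.cond,
    integral_smul_measure, ENNReal.toReal_inv, smul_eq_mul, smul_eq_mul, Measure.real,
    ← mul_assoc, ← mul_assoc, mul_inv_cancel₀ hne, one_mul]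

lemma integral_cellAvg [MeasurableSpace β] (hVmeas : ∀ k, MeasurableSet (𝒱 k))
    (hVpos : ∀ k, 0 < volume (𝒱 k)) (hVdisj : Pairwise (Function.onFun Disjoint 𝒱))
    (hVcover : (⋃ k, 𝒱 k) = C) (hCfin : volume C ≠ ⊤) {f : (Fin K → ℝ) → β → ℝ}
    (hf : Measurable (Function.uncurry f)) {a c : ℝ} (hfI : ∀ v ∈ C, ∀ b, f v b ∈ Icc a c)
    (b : β) : ∫ v in C, cellAvg 𝒱 f v b = ∫ v in C, f v b := by
  simpa using integral_cellAvg_mul hVmeas hVpos hVdisj hVcover hCfin hf hfI (w := fun _ => 1)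
    measurable_const (M := 1) (by simp) (by simp) b

lemma constSpline_LamQ {KZ : ℕ} {𝓧 𝓩 : Type*} (hVdisj : Pairwise (Function.onFun Disjoint 𝒱))
    (zs : Fin KZ → 𝓩) (x : 𝓩 → 𝓧) (m : Quint (Fin K → ℝ) 𝓧 𝓩) :
    ConstSpline 𝒱 zs x (LamQ 𝒱 m) := by
  intro k v hv v' hv' l
  simp only [LamQ, cellAvg_eq_integral_cond hVdisj _ hv,
    cellAvg_eq_integral_cond hVdisj _ hv', and_self]

/-- The bounds and McCormick inequalities at a single pair `(v, z)`. -/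
def McCormickIneq (b0L b0U b1L b1U bDL bDU m0 m1 mD m0D m1D : ℝ) : Prop :=
  (b0L ≤ m0 ∧ m0 ≤ b0U) ∧ (b1L ≤ m1 ∧ m1 ≤ b1U) ∧ (bDL ≤ mD ∧ mD ≤ bDU) ∧
  (m0D ≥ b0L * (1 - mD) + m0 * (1 - bDU) - b0L * (1 - bDU)) ∧
  (m0D ≥ b0U * (1 - mD) + m0 * (1 - bDL) - b0U * (1 - bDL)) ∧
  (m0D ≤ b0U * (1 - mD) + m0 * (1 - bDU) - b0U * (1 - bDU)) ∧
  (m0D ≤ b0L * (1 - mD) + m0 * (1 - bDL) - b0L * (1 - bDL)) ∧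
  (m1D ≥ b1L * mD + m1 * bDL - b1L * bDL) ∧
  (m1D ≥ b1U * mD + m1 * bDU - b1U * bDU) ∧
  (m1D ≤ b1U * mD + m1 * bDL - b1U * bDL) ∧
  (m1D ≤ b1L * mD + m1 * bDU - b1L * bDU)

/-- With constant bounds, the McCormick inequalities are inherited by means. -/
lemma McCormickIneq.integral {α : Type*} [MeasurableSpace α] {μ : Measure α}
    [IsProbabilityMeasure μ] {b0L b0U b1L b1U bDL bDU : ℝ} {m0 m1 mD m0D m1D : α → ℝ}
    (h0 : Integrable m0 μ) (h1 : Integrable m1 μ) (hD : Integrable mD μ)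
    (h0D : Integrable m0D μ) (h1D : Integrable m1D μ)
    (h : ∀ᵐ u ∂μ, McCormickIneq b0L b0U b1L b1U bDL bDU (m0 u) (m1 u) (mD u) (m0D u) (m1D u)) :
    McCormickIneq b0L b0U b1L b1U bDL bDU (∫ u, m0 u ∂μ) (∫ u, m1 u ∂μ) (∫ u, mD u ∂μ)
      (∫ u, m0D u ∂μ) (∫ u, m1D u ∂μ) := by
  have key0 := affine_integral_nonneg h0D hD h0
  have key1 := affine_integral_nonneg h1D hD h1
  refine ⟨mem_Icc_integral h0 (h.mono fun u hu => hu.1),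
    mem_Icc_integral h1 (h.mono fun u hu => hu.2.1),
    mem_Icc_integral hD (h.mono fun u hu => hu.2.2.1), ?_, ?_, ?_, ?_, ?_, ?_, ?_, ?_⟩
  · linarith [key0 (-(b0L * bDU)) 1 b0L (-(1 - bDU)) (h.mono fun u hu => by
      linarith [hu.2.2.2.1])]
  · linarith [key0 (-(b0U * bDL)) 1 b0U (-(1 - bDL)) (h.mono fun u hu => by
      linarith [hu.2.2.2.2.1])]
  · linarith [key0 (b0U * bDU) (-1) (-b0U) (1 - bDU) (h.mono fun u hu => by
      linarith [hu.2.2.2.2.2.1])]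
  · linarith [key0 (b0L * bDL) (-1) (-b0L) (1 - bDL) (h.mono fun u hu => by
      linarith [hu.2.2.2.2.2.2.1])]
  · linarith [key1 (b1L * bDL) 1 (-b1L) (-bDL) (h.mono fun u hu => by
      linarith [hu.2.2.2.2.2.2.2.1])]
  · linarith [key1 (b1U * bDU) 1 (-b1U) (-bDU) (h.mono fun u hu => by
      linarith [hu.2.2.2.2.2.2.2.2.1])]
  · linarith [key1 (-(b1U * bDL)) (-1) b1U bDL (h.mono fun u hu => by
      linarith [hu.2.2.2.2.2.2.2.2.2.1])]
  · linarith [key1 (-(b1L * bDU)) (-1) b1L bDU (h.mono fun u hu => by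
      linarith [hu.2.2.2.2.2.2.2.2.2.2])]

variable {𝓧 𝓩 : Type*} [MeasurableSpace 𝓧] [MeasurableSpace 𝓩] {yL yU : ℝ}
  {m : Quint (Fin K → ℝ) 𝓧 𝓩}

lemma InM.LamQ (hm : InM C yL yU m) (hVmeas : ∀ k, MeasurableSet (𝒱 k))
    (hVpos : ∀ k, 0 < volume (𝒱 k)) (hVdisj : Pairwise (Function.onFun Disjoint 𝒱))
    (hVcover : (⋃ k, 𝒱 k) = C) (hCfin : volume C ≠ ⊤) : InM C yL yU (LamQ 𝒱 m) := by
  obtain ⟨h0, h1, hD, h0D, h1D, i0, i1, iD, i0D, i1D⟩ := hm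
  exact ⟨measurable_cellAvg hVmeas h0, measurable_cellAvg hVmeas h1,
    measurable_cellAvg hVmeas hD, measurable_cellAvg hVmeas h0D, measurable_cellAvg hVmeas h1D,
    cellAvg_mem_Icc hVmeas hVpos hVdisj hVcover hCfin h0 i0,
    cellAvg_mem_Icc hVmeas hVpos hVdisj hVcover hCfin h1 i1,
    cellAvg_mem_Icc hVmeas hVpos hVdisj hVcover hCfin hD iD,
    cellAvg_mem_Icc hVmeas hVpos hVdisj hVcover hCfin h0D i0D,
    cellAvg_mem_Icc hVmeas hVpos hVdisj hVcover hCfin h1D i1D⟩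

lemma MomentOK.LamQ {Ω : Type*} [MeasurableSpace Ω] {P : Measure Ω} {Z : Ω → 𝓩}
    {D Y : Ω → ℝ} {s : 𝓩 → ℝ} (hs : MomentOK P Z D Y (volume.restrict C) m s)
    (hm : InM C yL yU m) (hVmeas : ∀ k, MeasurableSet (𝒱 k))
    (hVpos : ∀ k, 0 < volume (𝒱 k)) (hVdisj : Pairwise (Function.onFun Disjoint 𝒱))
    (hVcover : (⋃ k, 𝒱 k) = C) (hCfin : volume C ≠ ⊤) :
    MomentOK P Z D Y (volume.restrict C) (LamQ 𝒱 m) s := by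
  obtain ⟨-, -, hD, h0D, h1D, -, -, iD, i0D, i1D⟩ := hm
  simpa only [MomentOK, _root_.LamQ,
    integral_cellAvg hVmeas hVpos hVdisj hVcover hCfin hD iD,
    integral_cellAvg hVmeas hVpos hVdisj hVcover hCfin h0D i0D,
    integral_cellAvg hVmeas hVpos hVdisj hVcover hCfin h1D i1D] using hs

lemma McCormickOK.LamQ [MeasurableSingletonClass 𝓩] {x : 𝓩 → 𝓧} {μ : Measure 𝓩} [SFinite μ]
    {KZ : ℕ} {zs : Fin KZ → 𝓩} (hμ : ∀ᵐ z ∂μ, ∃ l, z = zs l) (hμpos : ∀ l, μ {zs l} ≠ 0)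
    {b0L b0U b1L b1U : (Fin K → ℝ) → 𝓧 → ℝ} {bDL bDU : (Fin K → ℝ) → 𝓩 → ℝ}
    (hmc : McCormickOK x ((volume.restrict C).prod μ) m b0L b0U b1L b1U bDL bDU)
    (hm : InM C yL yU m) (hVmeas : ∀ k, MeasurableSet (𝒱 k))
    (hVpos : ∀ k, 0 < volume (𝒱 k)) (hVdisj : Pairwise (Function.onFun Disjoint 𝒱))
    (hVcover : (⋃ k, 𝒱 k) = C) (hCfin : volume C ≠ ⊤)
    (hbconst : ∀ k : Fin KV, ∀ v ∈ 𝒱 k, ∀ v' ∈ 𝒱 k, ∀ l : Fin KZ,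
      b0L v (x (zs l)) = b0L v' (x (zs l)) ∧ b0U v (x (zs l)) = b0U v' (x (zs l)) ∧
      b1L v (x (zs l)) = b1L v' (x (zs l)) ∧ b1U v (x (zs l)) = b1U v' (x (zs l)) ∧
      bDL v (zs l) = bDL v' (zs l) ∧ bDU v (zs l) = bDU v' (zs l)) :
    McCormickOK x ((volume.restrict C).prod μ) (LamQ 𝒱 m) b0L b0U b1L b1U bDL bDU := by
  have hC : MeasurableSet C := hVcover ▸ MeasurableSet.iUnion hVmeas
  have hslice := Measure.ae_ae_of_ae_prod hmc
  have hfst : ∀ᵐ p ∂(volume.restrict C).prod μ, p.1 ∈ C :=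
    Measure.quasiMeasurePreserving_fst.ae (ae_restrict_mem hC)
  have hsnd : ∀ᵐ p ∂(volume.restrict C).prod μ, ∃ l, p.2 = zs l :=
    Measure.quasiMeasurePreserving_snd.ae hμ
  obtain ⟨h0, h1, hD, h0D, h1D, i0, i1, iD, i0D, i1D⟩ := hm
  filter_upwards [hfst, hsnd] with ⟨v, z⟩ hv ⟨l, hl⟩
  dsimp only at hv hl ⊢
  subst hl
  obtain ⟨k, hk⟩ := mem_iUnion.1 (hVcover ▸ hv)
  have hsub : 𝒱 k ⊆ C := hVcover ▸ subset_iUnion 𝒱 k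
  have : IsProbabilityMeasure volume[|𝒱 k] :=
    cond_isProbabilityMeasure_of_finite (hVpos k).ne' (measure_ne_top_of_subset hsub hCfin)
  have hac : volume[|𝒱 k] ≪ volume.restrict C :=
    (Measure.smul_absolutelyContinuous).trans (Measure.restrict_mono hsub le_rfl).absolutelyContinuous
  have J0 := integrable_cond_of_integrableOn (hVpos k).ne' hsub
    (integrableOn_of_mem_Icc hC hCfin h0 i0 (x (zs l)))
  have J1 := integrable_cond_of_integrableOn (hVpos k).ne' hsub
    (integrableOn_of_mem_Icc hC hCfin h1 i1 (x (zs l)))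
  have JD := integrable_cond_of_integrableOn (hVpos k).ne' hsub
    (integrableOn_of_mem_Icc hC hCfin hD iD (zs l))
  have J0D := integrable_cond_of_integrableOn (hVpos k).ne' hsub
    (integrableOn_of_mem_Icc hC hCfin h0D i0D (zs l))
  have J1D := integrable_cond_of_integrableOn (hVpos k).ne' hsub
    (integrableOn_of_mem_Icc hC hCfin h1D i1D (zs l))
  have hatom : ∀ᵐ u ∂volume[|𝒱 k],
      McCormickIneq (b0L v (x (zs l))) (b0U v (x (zs l))) (b1L v (x (zs l)))
        (b1U v (x (zs l))) (bDL v (zs l)) (bDU v (zs l)) (m.m0 u (x (zs l)))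
        (m.m1 u (x (zs l))) (m.mD u (zs l)) (m.m0D u (zs l)) (m.m1D u (zs l)) := by
    filter_upwards [hac.ae_le hslice, ae_cond_mem (hVmeas k)] with u hu hmem
    have hu' : McCormickIneq (b0L u (x (zs l))) (b0U u (x (zs l))) (b1L u (x (zs l)))
        (b1U u (x (zs l))) (bDL u (zs l)) (bDU u (zs l)) (m.m0 u (x (zs l)))
        (m.m1 u (x (zs l))) (m.mD u (zs l)) (m.m0D u (zs l)) (m.m1D u (zs l)) := by
      by_contra hcon
      exact hμpos l (measure_mono_null (singleton_subset_iff.2 hcon) hu)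
    obtain ⟨e1, e2, e3, e4, e5, e6⟩ := hbconst k u hmem v hk l
    rwa [e1, e2, e3, e4, e5, e6] at hu'
  have hmean := McCormickIneq.integral J0 J1 JD J0D J1D hatom
  simpa only [McCormickIneq, _root_.LamQ, cellAvg_eq_integral_cond hVdisj _ hk] using hmean

/-- The `v`-integral in `Γ*` split into the contributions of the components of `m`. -/
lemma InM.integral_gamma_eq (hm : InM C yL yU m) (hC : MeasurableSet C)
    (hCfin : volume C ≠ ⊤) {w00 w01 w10 w11 : (Fin K → ℝ) → ℝ} (h00 : Measurable w00)
    (h01 : Measurable w01) (h10 : Measurable w10) (h11 : Measurable w11) {M : ℝ}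
    (hM : ∀ v, |w00 v| ≤ M ∧ |w01 v| ≤ M ∧ |w10 v| ≤ M ∧ |w11 v| ≤ M) (ξ : 𝓧) (z : 𝓩) :
    ∫ v in C, (m.m0D v z * w00 v + (m.m0 v ξ - m.m0D v z) * w01 v
      + (m.m1 v ξ - m.m1D v z) * w10 v + m.m1D v z * w11 v) =
    ((∫ v in C, m.m0D v z * w00 v) + ((∫ v in C, m.m0 v ξ * w01 v)
      - ∫ v in C, m.m0D v z * w01 v)) + ((∫ v in C, m.m1 v ξ * w10 v)
      - ∫ v in C, m.m1D v z * w10 v) + ∫ v in C, m.m1D v z * w11 v := by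
  obtain ⟨m0, m1, -, m0D, m1D, i0, i1, -, i0D, i1D⟩ := hm
  have I1 := integrableOn_mul_of_mem_Icc hC hCfin m0D i0D h00 (fun v => (hM v).1) z
  have I2 := integrableOn_mul_of_mem_Icc hC hCfin m0 i0 h01 (fun v => (hM v).2.1) ξ
  have I3 := integrableOn_mul_of_mem_Icc hC hCfin m0D i0D h01 (fun v => (hM v).2.1) z
  have I4 := integrableOn_mul_of_mem_Icc hC hCfin m1 i1 h10 (fun v => (hM v).2.2.1) ξ
  have I5 := integrableOn_mul_of_mem_Icc hC hCfin m1D i1D h10 (fun v => (hM v).2.2.1) z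
  have I6 := integrableOn_mul_of_mem_Icc hC hCfin m1D i1D h11 (fun v => (hM v).2.2.2) z
  simp only [sub_mul]
  refine (integral_add ((I1.add (I2.sub I3)).add (I4.sub I5)) I6).trans (congrArg (· + _) ?_)
  refine (integral_add (I1.add (I2.sub I3)) (I4.sub I5)).trans
    (congrArg₂ (· + ·) ?_ (integral_sub I4 I5))
  exact (integral_add I1 (I2.sub I3)).trans (congrArg (_ + ·) (integral_sub I2 I3))

lemma GammaStar_LamQ {Ω : Type*} [MeasurableSpace Ω] {P : Measure Ω} {Z : Ω → 𝓩} {x : 𝓩 → 𝓧}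
    {KZ : ℕ} {zs : Fin KZ → 𝓩} (hzsupp : ∀ᵐ ω ∂P, ∃ l : Fin KZ, Z ω = zs l)
    (hm : InM C yL yU m) (hVmeas : ∀ k, MeasurableSet (𝒱 k))
    (hVpos : ∀ k, 0 < volume (𝒱 k)) (hVdisj : Pairwise (Function.onFun Disjoint 𝒱))
    (hVcover : (⋃ k, 𝒱 k) = C) (hCfin : volume C ≠ ⊤)
    {ω00 ω01 ω10 ω11 : (Fin K → ℝ) → 𝓩 → ℝ}
    (hω : Measurable (Function.uncurry ω00) ∧ Measurable (Function.uncurry ω01) ∧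
      Measurable (Function.uncurry ω10) ∧ Measurable (Function.uncurry ω11)) {M : ℝ}
    (hM : ∀ v z, |ω00 v z| ≤ M ∧ |ω01 v z| ≤ M ∧ |ω10 v z| ≤ M ∧ |ω11 v z| ≤ M)
    (hωconst : ∀ k : Fin KV, ∀ v ∈ 𝒱 k, ∀ v' ∈ 𝒱 k, ∀ l : Fin KZ,
      ω00 v (zs l) = ω00 v' (zs l) ∧ ω01 v (zs l) = ω01 v' (zs l) ∧
      ω10 v (zs l) = ω10 v' (zs l) ∧ ω11 v (zs l) = ω11 v' (zs l)) :
    GammaStar P Z x (volume.restrict C) ω00 ω01 ω10 ω11 (LamQ 𝒱 m) =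
      GammaStar P Z x (volume.restrict C) ω00 ω01 ω10 ω11 m := by
  have hC : MeasurableSet C := hVcover ▸ MeasurableSet.iUnion hVmeas
  refine integral_congr_ae ?_
  filter_upwards [hzsupp] with ω ⟨l, hl⟩
  have h00 : Measurable fun v => ω00 v (Z ω) := hω.1.of_uncurry_right
  have h01 : Measurable fun v => ω01 v (Z ω) := hω.2.1.of_uncurry_right
  have h10 : Measurable fun v => ω10 v (Z ω) := hω.2.2.1.of_uncurry_right
  have h11 : Measurable fun v => ω11 v (Z ω) := hω.2.2.2.of_uncurry_right
  have hM' := fun v => hM v (Z ω)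
  rw [(hm.LamQ hVmeas hVpos hVdisj hVcover hCfin).integral_gamma_eq hC hCfin h00 h01 h10 h11 hM',
    hm.integral_gamma_eq hC hCfin h00 h01 h10 h11 hM']
  obtain ⟨m0, m1, -, m0D, m1D, i0, i1, -, i0D, i1D⟩ := hm
  have c00 : ∀ k, ∀ v ∈ 𝒱 k, ∀ v' ∈ 𝒱 k, ω00 v (Z ω) = ω00 v' (Z ω) :=
    fun k v hv v' hv' => hl ▸ (hωconst k v hv v' hv' l).1
  have c01 : ∀ k, ∀ v ∈ 𝒱 k, ∀ v' ∈ 𝒱 k, ω01 v (Z ω) = ω01 v' (Z ω) :=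
    fun k v hv v' hv' => hl ▸ (hωconst k v hv v' hv' l).2.1
  have c10 : ∀ k, ∀ v ∈ 𝒱 k, ∀ v' ∈ 𝒱 k, ω10 v (Z ω) = ω10 v' (Z ω) :=
    fun k v hv v' hv' => hl ▸ (hωconst k v hv v' hv' l).2.2.1
  have c11 : ∀ k, ∀ v ∈ 𝒱 k, ∀ v' ∈ 𝒱 k, ω11 v (Z ω) = ω11 v' (Z ω) :=
    fun k v hv v' hv' => hl ▸ (hωconst k v hv v' hv' l).2.2.2
  simp only [LamQ]
  rw [integral_cellAvg_mul hVmeas hVpos hVdisj hVcover hCfin m0D i0D h00 (fun v => (hM' v).1) c00,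
    integral_cellAvg_mul hVmeas hVpos hVdisj hVcover hCfin m0 i0 h01 (fun v => (hM' v).2.1) c01,
    integral_cellAvg_mul hVmeas hVpos hVdisj hVcover hCfin m0D i0D h01 (fun v => (hM' v).2.1) c01,
    integral_cellAvg_mul hVmeas hVpos hVdisj hVcover hCfin m1 i1 h10 (fun v => (hM' v).2.2.1) c10,
    integral_cellAvg_mul hVmeas hVpos hVdisj hVcover hCfin m1D i1D h10
      (fun v => (hM' v).2.2.1) c10,
    integral_cellAvg_mul hVmeas hVpos hVdisj hVcover hCfin m1D i1D h11
      (fun v => (hM' v).2.2.2) c11]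

end CellAverage

/-- Proposition 2 of the paper: with discrete instruments and a partition on whose cells
the weights and bound functions are constant, cell averaging preserves feasibility and the
value of `Γ*`; hence optimizing over constant splines entails no loss. -/
theorem stmt_10
    {Ω : Type*} [MeasurableSpace Ω] (P : Measure Ω) [IsProbabilityMeasure P]
    {𝓩 𝓧 : Type*} [MeasurableSpace 𝓩] [StandardBorelSpace 𝓩]
    [MeasurableSpace 𝓧] [StandardBorelSpace 𝓧]
    (x : 𝓩 → 𝓧) (hx : Measurable x)
    (Z : Ω → 𝓩) (hZ : Measurable Z)
    (K : ℕ) (hK : 1 ≤ K)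
    (D : Ω → ℝ) (hD : Measurable D) (hD01 : ∀ ω, D ω = 0 ∨ D ω = 1)
    (Y : Ω → ℝ) (hY : Measurable Y)
    (yL yU : ℝ) (hy : yL ≤ yU) (hbd : ∀ ω, Y ω ∈ Set.Icc yL yU)
    -- the instrument has finite support `{z_1, ..., z_{K_Z}}`
    (KZ : ℕ) (zs : Fin KZ → 𝓩)
    (hzsupp : ∀ᵐ ω ∂P, ∃ l : Fin KZ, Z ω = zs l)
    (hzpos : ∀ l : Fin KZ, 0 < P {ω | Z ω = zs l})
    -- the family of IV-like functions
    (𝒮 : Set (𝓩 → ℝ)) (h𝒮 : ∀ s ∈ 𝒮, Measurable s)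
    -- bounded measurable weight functions
    (ω00 ω01 ω10 ω11 : (Fin K → ℝ) → 𝓩 → ℝ)
    (hω : Measurable (Function.uncurry ω00) ∧ Measurable (Function.uncurry ω01) ∧
      Measurable (Function.uncurry ω10) ∧ Measurable (Function.uncurry ω11))
    (hωbd : ∃ C : ℝ, ∀ v z, |ω00 v z| ≤ C ∧ |ω01 v z| ≤ C ∧ |ω10 v z| ≤ C ∧ |ω11 v z| ≤ C)
    -- measurable bound functions
    (b0L b0U b1L b1U : (Fin K → ℝ) → 𝓧 → ℝ) (bDL bDU : (Fin K → ℝ) → 𝓩 → ℝ)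
    (hb : Measurable (Function.uncurry b0L) ∧ Measurable (Function.uncurry b0U) ∧
      Measurable (Function.uncurry b1L) ∧ Measurable (Function.uncurry b1U) ∧
      Measurable (Function.uncurry bDL) ∧ Measurable (Function.uncurry bDU))
    -- a finite measurable partition of the cube with cells of positive measure
    (KV : ℕ) (𝒱 : Fin KV → Set (Fin K → ℝ))
    (hVmeas : ∀ k, MeasurableSet (𝒱 k))
    (hVpos : ∀ k, 0 < volume (𝒱 k))
    (hVdisj : Pairwise (Function.onFun Disjoint 𝒱))
    (hVcover : (⋃ k, 𝒱 k) = Set.Icc (0 : Fin K → ℝ) 1)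
    -- the weights and bound functions are constant in `v` on each cell, for every point
    -- of the (finite) support of the instrument
    (hωconst : ∀ k : Fin KV, ∀ v ∈ 𝒱 k, ∀ v' ∈ 𝒱 k, ∀ l : Fin KZ,
      ω00 v (zs l) = ω00 v' (zs l) ∧ ω01 v (zs l) = ω01 v' (zs l) ∧
      ω10 v (zs l) = ω10 v' (zs l) ∧ ω11 v (zs l) = ω11 v' (zs l))
    (hbconst : ∀ k : Fin KV, ∀ v ∈ 𝒱 k, ∀ v' ∈ 𝒱 k, ∀ l : Fin KZ,
      b0L v (x (zs l)) = b0L v' (x (zs l)) ∧ b0U v (x (zs l)) = b0U v' (x (zs l)) ∧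
      b1L v (x (zs l)) = b1L v' (x (zs l)) ∧ b1U v (x (zs l)) = b1U v' (x (zs l)) ∧
      bDL v (zs l) = bDL v' (zs l) ∧ bDU v (zs l) = bDU v' (zs l)) :
    -- (1) cell averaging preserves membership in `ℳ`, produces a constant spline,
    --     preserves feasibility, and preserves `Γ*`
    (∀ m : Quint (Fin K → ℝ) 𝓧 𝓩,
      InM (Set.Icc (0 : Fin K → ℝ) 1) yL yU m →
      (∀ s ∈ 𝒮, MomentOK P Z D Y (volume.restrict (Set.Icc (0 : Fin K → ℝ) 1)) m s) →
      McCormickOK x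
        ((volume.restrict (Set.Icc (0 : Fin K → ℝ) 1)).prod (Measure.map Z P))
        m b0L b0U b1L b1U bDL bDU →
      InM (Set.Icc (0 : Fin K → ℝ) 1) yL yU (LamQ 𝒱 m) ∧
      ConstSpline 𝒱 zs x (LamQ 𝒱 m) ∧
      (∀ s ∈ 𝒮, MomentOK P Z D Y (volume.restrict (Set.Icc (0 : Fin K → ℝ) 1))
        (LamQ 𝒱 m) s) ∧
      McCormickOK x
        ((volume.restrict (Set.Icc (0 : Fin K → ℝ) 1)).prod (Measure.map Z P))
        (LamQ 𝒱 m) b0L b0U b1L b1U bDL bDU ∧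
      GammaStar P Z x (volume.restrict (Set.Icc (0 : Fin K → ℝ) 1))
        ω00 ω01 ω10 ω11 (LamQ 𝒱 m)
        = GammaStar P Z x (volume.restrict (Set.Icc (0 : Fin K → ℝ) 1))
            ω00 ω01 ω10 ω11 m) ∧
    -- (2) the lower bound is unchanged when restricting to constant splines
    (sInf {r : ℝ | ∃ m : Quint (Fin K → ℝ) 𝓧 𝓩,
        InM (Set.Icc (0 : Fin K → ℝ) 1) yL yU m ∧
        (∀ s ∈ 𝒮, MomentOK P Z D Y (volume.restrict (Set.Icc (0 : Fin K → ℝ) 1)) m s) ∧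
        McCormickOK x
          ((volume.restrict (Set.Icc (0 : Fin K → ℝ) 1)).prod (Measure.map Z P))
          m b0L b0U b1L b1U bDL bDU ∧
        GammaStar P Z x (volume.restrict (Set.Icc (0 : Fin K → ℝ) 1))
          ω00 ω01 ω10 ω11 m = r}
      = sInf {r : ℝ | ∃ m : Quint (Fin K → ℝ) 𝓧 𝓩,
          InM (Set.Icc (0 : Fin K → ℝ) 1) yL yU m ∧
          (∀ s ∈ 𝒮, MomentOK P Z D Y (volume.restrict (Set.Icc (0 : Fin K → ℝ) 1)) m s) ∧
          McCormickOK x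
            ((volume.restrict (Set.Icc (0 : Fin K → ℝ) 1)).prod (Measure.map Z P))
            m b0L b0U b1L b1U bDL bDU ∧
          ConstSpline 𝒱 zs x m ∧
          GammaStar P Z x (volume.restrict (Set.Icc (0 : Fin K → ℝ) 1))
            ω00 ω01 ω10 ω11 m = r}) ∧
    -- (3) the upper bound is unchanged when restricting to constant splines
    (sSup {r : ℝ | ∃ m : Quint (Fin K → ℝ) 𝓧 𝓩,
        InM (Set.Icc (0 : Fin K → ℝ) 1) yL yU m ∧
        (∀ s ∈ 𝒮, MomentOK P Z D Y (volume.restrict (Set.Icc (0 : Fin K → ℝ) 1)) m s) ∧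
        McCormickOK x
          ((volume.restrict (Set.Icc (0 : Fin K → ℝ) 1)).prod (Measure.map Z P))
          m b0L b0U b1L b1U bDL bDU ∧
        GammaStar P Z x (volume.restrict (Set.Icc (0 : Fin K → ℝ) 1))
          ω00 ω01 ω10 ω11 m = r}
      = sSup {r : ℝ | ∃ m : Quint (Fin K → ℝ) 𝓧 𝓩,
          InM (Set.Icc (0 : Fin K → ℝ) 1) yL yU m ∧
          (∀ s ∈ 𝒮, MomentOK P Z D Y (volume.restrict (Set.Icc (0 : Fin K → ℝ) 1)) m s) ∧
          McCormickOK x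
            ((volume.restrict (Set.Icc (0 : Fin K → ℝ) 1)).prod (Measure.map Z P))
            m b0L b0U b1L b1U bDL bDU ∧
          ConstSpline 𝒱 zs x m ∧
          GammaStar P Z x (volume.restrict (Set.Icc (0 : Fin K → ℝ) 1))
            ω00 ω01 ω10 ω11 m = r}) := by
  have hCfin : volume (Icc (0 : Fin K → ℝ) 1) ≠ ⊤ := isCompact_Icc.measure_ne_top
  obtain ⟨M, hM⟩ := hωbd
  have hμ : ∀ᵐ z ∂Measure.map Z P, ∃ l, z = zs l := by
    have hset : MeasurableSet {z | ∃ l, z = zs l} := by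
      have : {z | ∃ l, z = zs l} = range zs := by
        ext z
        simp [eq_comm]
      exact this ▸ (finite_range zs).measurableSet
    exact (ae_map_iff hZ.aemeasurable hset).2 hzsupp
  have hμpos : ∀ l, Measure.map Z P {zs l} ≠ 0 := fun l => by
    rw [Measure.map_apply hZ (measurableSet_singleton _)]
    exact (hzpos l).ne'
  refine (fun h => ⟨h, ?_, ?_⟩) fun m hm hmom hmc =>
    ⟨hm.LamQ hVmeas hVpos hVdisj hVcover hCfin, constSpline_LamQ hVdisj zs x m,
      fun s hs => (hmom s hs).LamQ hm hVmeas hVpos hVdisj hVcover hCfin,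
      hmc.LamQ hμ hμpos hm hVmeas hVpos hVdisj hVcover hCfin hbconst,
      GammaStar_LamQ hzsupp hm hVmeas hVpos hVdisj hVcover hCfin hω hM hωconst⟩
  all_goals
    congr 1
    ext r
    constructor
    · rintro ⟨m, hm, hmom, hmc, hr⟩
      obtain ⟨hm', hspl, hmom', hmc', hΓ⟩ := h m hm hmom hmc
      exact ⟨LamQ 𝒱 m, hm', hmom', hmc', hspl, hΓ.trans hr⟩
    · rintro ⟨m, hm, hmom, hmc, -, hr⟩
      exact ⟨m, hm, hmom, hmc, hr⟩
end

section
/- Under Assumption 1, for every measurable set 𝒳* ⊆ 𝒳 with ℙ(X ∈ 𝒳*) > 0 and for d = 0,1: E[Y_d·1{X ∈ 𝒳*}] = E[1{X ∈ 𝒳*}·∫ m_d(v, X) dv]; consequently E[Y_1 − Y_0 | X ∈ 𝒳*] = E[1{X ∈ 𝒳*}·∫ (m_1(v, X) − m_0(v, X)) dv] / ℙ(X ∈ 𝒳*). -/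
open MeasureTheory ProbabilityTheory

/-- If `V` and `W` are independent and `m (V, W)` is a version of `E[Y | V, W]`, then integrating
`m` over the law of `V` recovers the integral of `Y` over events determined by `W`. -/
theorem setIntegral_eq_setIntegral_integral_of_condExp_ae_eq
    {Ω E F : Type*} [MeasurableSpace Ω] {P : Measure Ω} [IsProbabilityMeasure P]
    [MeasurableSpace E] [MeasurableSpace F] {V : Ω → E} {W : Ω → F} {Y : Ω → ℝ} {m : E → F → ℝ}
    (hV : Measurable V) (hW : Measurable W) (hVW : IndepFun V W P)
    (hY : Integrable Y P) (hm : Measurable (Function.uncurry m))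
    (hmY : P[Y | MeasurableSpace.comap (fun ω => (V ω, W ω)) inferInstance]
      =ᵐ[P] fun ω => m (V ω) (W ω))
    {S : Set F} (hS : MeasurableSet S) :
    ∫ ω in W ⁻¹' S, Y ω ∂P = ∫ ω in W ⁻¹' S, ∫ v, m v (W ω) ∂(P.map V) ∂P := by
  have hVWm : Measurable fun ω => (V ω, W ω) := hV.prodMk hW
  have := Measure.isProbabilityMeasure_map (μ := P) hV.aemeasurable
  have := Measure.isProbabilityMeasure_map (μ := P) hW.aemeasurable
  have hprod : P.map (fun ω => (V ω, W ω)) = (P.map V).prod (P.map W) :=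
    (indepFun_iff_map_prod_eq_prod_map_map hV.aemeasurable hW.aemeasurable).1 hVW
  have hint : Integrable (Function.uncurry m) ((P.map V).prod (P.map W)) := by
    rw [← hprod, integrable_map_measure hm.aestronglyMeasurable hVWm.aemeasurable]
    exact integrable_condExp.congr hmY
  have hpre : W ⁻¹' S = (fun ω => (V ω, W ω)) ⁻¹' (Set.univ ×ˢ S) := by
    ext; simp
  have hS' : MeasurableSet ((Set.univ : Set E) ×ˢ S) := MeasurableSet.univ.prod hS
  calc ∫ ω in W ⁻¹' S, Y ω ∂P
      = ∫ ω in W ⁻¹' S, m (V ω) (W ω) ∂P := by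
        rw [← setIntegral_condExp hVWm.comap_le hY (s := W ⁻¹' S) ⟨_, hS', hpre.symm⟩]
        exact integral_congr_ae (ae_restrict_of_ae hmY)
    _ = ∫ p in Set.univ ×ˢ S, Function.uncurry m p ∂((P.map V).prod (P.map W)) := by
        rw [← hprod, setIntegral_map hS' hm.aestronglyMeasurable hVWm.aemeasurable, ← hpre]
        rfl
    _ = ∫ w in S, ∫ v, m v w ∂(P.map V) ∂(P.map W) := by
        rw [← Measure.prod_restrict, Measure.restrict_univ, integral_prod_symm]
        · rfl
        · have h := hint.integrableOn (s := Set.univ ×ˢ S)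
          rwa [IntegrableOn, ← Measure.prod_restrict, Measure.restrict_univ] at h
    _ = ∫ ω in W ⁻¹' S, ∫ v, m v (W ω) ∂(P.map V) ∂P :=
        setIntegral_map hS
          (hm.stronglyMeasurable.integral_prod_left).aestronglyMeasurable hW.aemeasurable

/-- Under Assumption 1, for a covariate event `{X ∈ 𝒳*}` with positive probability,
`E[Y_d·1{X ∈ 𝒳*}] = E[1{X ∈ 𝒳*}·∫ m_d(v, X) dv]`, and the conditional average treatment
effect given `X ∈ 𝒳*` equals `E[1{X ∈ 𝒳*}·∫ (m₁ - m₀) dv] / ℙ(X ∈ 𝒳*)`. -/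
theorem stmt_12
    {Ω : Type*} [MeasurableSpace Ω] (P : Measure Ω) [IsProbabilityMeasure P]
    {𝓩 𝓧 : Type*} [MeasurableSpace 𝓩] [StandardBorelSpace 𝓩]
    [MeasurableSpace 𝓧] [StandardBorelSpace 𝓧]
    (x : 𝓩 → 𝓧) (hx : Measurable x)
    (Z : Ω → 𝓩) (hZ : Measurable Z)
    (K : ℕ) (hK : 1 ≤ K)
    (V : Ω → (Fin K → ℝ)) (hV : Measurable V)
    (D : Ω → ℝ) (hD : Measurable D) (hD01 : ∀ ω, D ω = 0 ∨ D ω = 1)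
    (Y0 Y1 : Ω → ℝ) (hY0 : Measurable Y0) (hY1 : Measurable Y1)
    (yL yU : ℝ) (hy : yL ≤ yU)
    (hbd0 : ∀ ω, Y0 ω ∈ Set.Icc yL yU) (hbd1 : ∀ ω, Y1 ω ∈ Set.Icc yL yU)
    -- Assumption 1 (i)
    (hA10 : P[Y0 | MeasurableSpace.comap (fun ω => (D ω, Z ω, V ω)) inferInstance]
        =ᵐ[P] P[Y0 | MeasurableSpace.comap (fun ω => (x (Z ω), V ω)) inferInstance])
    (hA11 : P[Y1 | MeasurableSpace.comap (fun ω => (D ω, Z ω, V ω)) inferInstance]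
        =ᵐ[P] P[Y1 | MeasurableSpace.comap (fun ω => (x (Z ω), V ω)) inferInstance])
    -- Assumption 1 (ii)
    (hVZ : IndepFun V Z P)
    (hVunif : Measure.map V P = volume.restrict (Set.Icc (0 : Fin K → ℝ) 1))
    -- the marginal treatment response functions and the propensity score
    (m0 m1 : (Fin K → ℝ) → 𝓧 → ℝ) (mD : (Fin K → ℝ) → 𝓩 → ℝ)
    (hm0 : Measurable (Function.uncurry m0))
    (hm1 : Measurable (Function.uncurry m1))
    (hmD : Measurable (Function.uncurry mD))
    (hm0v : P[Y0 | MeasurableSpace.comap (fun ω => (V ω, x (Z ω))) inferInstance]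
        =ᵐ[P] fun ω => m0 (V ω) (x (Z ω)))
    (hm1v : P[Y1 | MeasurableSpace.comap (fun ω => (V ω, x (Z ω))) inferInstance]
        =ᵐ[P] fun ω => m1 (V ω) (x (Z ω)))
    (hmDv : P[D | MeasurableSpace.comap (fun ω => (V ω, Z ω)) inferInstance]
        =ᵐ[P] fun ω => mD (V ω) (Z ω))
    (XStar : Set 𝓧) (hXStar : MeasurableSet XStar)
    (hXpos : 0 < P {ω | x (Z ω) ∈ XStar}) :
    ((∫ ω, Set.indicator {ω' | x (Z ω') ∈ XStar} Y0 ω ∂P)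
        = ∫ ω, Set.indicator {ω' | x (Z ω') ∈ XStar}
            (fun ω' => ∫ v in Set.Icc (0 : Fin K → ℝ) 1, m0 v (x (Z ω')) ∂volume) ω ∂P) ∧
    ((∫ ω, Set.indicator {ω' | x (Z ω') ∈ XStar} Y1 ω ∂P)
        = ∫ ω, Set.indicator {ω' | x (Z ω') ∈ XStar}
            (fun ω' => ∫ v in Set.Icc (0 : Fin K → ℝ) 1, m1 v (x (Z ω')) ∂volume) ω ∂P) ∧
    ((∫ ω, (Y1 ω - Y0 ω) ∂(P[|{ω | x (Z ω) ∈ XStar}]))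
        = (∫ ω, Set.indicator {ω' | x (Z ω') ∈ XStar}
            (fun ω' => ∫ v in Set.Icc (0 : Fin K → ℝ) 1,
              (m1 v (x (Z ω')) - m0 v (x (Z ω'))) ∂volume) ω ∂P)
          / (P {ω | x (Z ω) ∈ XStar}).toReal) := by
  have hX : Measurable fun ω => x (Z ω) := hx.comp hZ
  have hVX : IndepFun V (fun ω => x (Z ω)) P := hVZ.comp measurable_id hx
  have hi0 : Integrable Y0 P := .of_mem_Icc yL yU hY0.aemeasurable (.of_forall hbd0)
  have hi1 : Integrable Y1 P := .of_mem_Icc yL yU hY1.aemeasurable (.of_forall hbd1)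
  have hS : MeasurableSet {ω | x (Z ω) ∈ XStar} := hX hXStar
  have hdiff : P[fun ω => Y1 ω - Y0 ω | MeasurableSpace.comap (fun ω => (V ω, x (Z ω)))
      inferInstance] =ᵐ[P] fun ω => m1 (V ω) (x (Z ω)) - m0 (V ω) (x (Z ω)) :=
    (condExp_sub hi1 hi0 _).trans (hm1v.sub hm0v)
  have h0 := setIntegral_eq_setIntegral_integral_of_condExp_ae_eq hV hX hVX hi0 hm0 hm0v hXStar
  have h1 := setIntegral_eq_setIntegral_integral_of_condExp_ae_eq hV hX hVX hi1 hm1 hm1v hXStar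
  have h2 := setIntegral_eq_setIntegral_integral_of_condExp_ae_eq
    (m := fun v w => m1 v w - m0 v w) hV hX hVX (hi1.sub hi0) (hm1.sub hm0) hdiff hXStar
  rw [hVunif] at h0 h1 h2
  simp_rw [integral_indicator hS]
  refine ⟨h0, h1, ?_⟩
  rw [ProbabilityTheory.cond, integral_smul_measure, ENNReal.toReal_inv, smul_eq_mul, mul_comm,
    ← div_eq_mul_inv]
  exact congrArg (· / _) h2
end

section
/- Under Assumption 1, for d = 0,1: E[Y_d·D] = E[∫ m_d(v, X)·m_D(v, Z) dv] and E[Y_d·(1−D)] = E[∫ m_d(v, X)·(1 − m_D(v, Z)) dv]. Consequently, if 0 < ℙ(D = 1) < 1, then the average treatment effect on the treated satisfies E[Y_1 − Y_0 | D = 1] = E[∫ (m_1(v,X) − m_0(v,X))·m_D(v,Z) dv] / ℙ(D = 1), and the average treatment effect on the untreated satisfies E[Y_1 − Y_0 | D = 0] = E[∫ (m_1(v,X) − m_0(v,X))·(1 − m_D(v,Z)) dv] / ℙ(D = 0). -/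
open MeasureTheory ProbabilityTheory

theorem integral_mul_eq_of_condExp_ae_eq {Ω : Type*} {m mΩ : MeasurableSpace Ω} {P : Measure Ω}
    [IsFiniteMeasure P] (hm : m ≤ mΩ) {Y W a : Ω → ℝ} (hW : StronglyMeasurable[m] W)
    (hY : Integrable Y P) (hYW : Integrable (Y * W) P) (ha : P[Y|m] =ᵐ[P] a) :
    ∫ ω, Y ω * W ω ∂P = ∫ ω, a ω * W ω ∂P := by
  have h := condExp_mul_of_stronglyMeasurable_right hW hYW hY
  calc ∫ ω, Y ω * W ω ∂P = ∫ ω, (P[Y * W|m]) ω ∂P := (integral_condExp hm).symm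
    _ = ∫ ω, a ω * W ω ∂P := by
      refine integral_congr_ae ?_
      filter_upwards [h, ha] with ω h1 h2
      rw [h1, Pi.mul_apply, h2]

theorem integral_comp_eq_of_indepFun {Ω α β : Type*} [MeasurableSpace Ω] [MeasurableSpace α]
    [MeasurableSpace β] {P : Measure Ω} [IsProbabilityMeasure P] {V : Ω → α} {Z : Ω → β}
    (hV : Measurable V) (hZ : Measurable Z) (hVZ : IndepFun V Z P) {f : α → β → ℝ}
    (hf : Measurable (Function.uncurry f)) (hint : Integrable (fun ω => f (V ω) (Z ω)) P) :
    ∫ ω, f (V ω) (Z ω) ∂P = ∫ ω, ∫ v, f v (Z ω) ∂(P.map V) ∂P := by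
  have := Measure.isProbabilityMeasure_map (μ := P) hV.aemeasurable
  have := Measure.isProbabilityMeasure_map (μ := P) hZ.aemeasurable
  have hprod := (indepFun_iff_map_prod_eq_prod_map_map hV.aemeasurable hZ.aemeasurable).1 hVZ
  have hint' : Integrable (Function.uncurry f) ((P.map V).prod (P.map Z)) := by
    rw [← hprod, integrable_map_measure hf.aestronglyMeasurable (hV.prodMk hZ).aemeasurable]
    exact hint
  calc ∫ ω, f (V ω) (Z ω) ∂P
      = ∫ p, Function.uncurry f p ∂(P.map fun ω => (V ω, Z ω)) :=
        (integral_map (hV.prodMk hZ).aemeasurable hf.aestronglyMeasurable).symm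
    _ = ∫ z, ∫ v, f v z ∂(P.map V) ∂(P.map Z) := by
        rw [hprod, integral_prod_symm _ hint']; rfl
    _ = ∫ ω, ∫ v, f v (Z ω) ∂(P.map V) ∂P :=
        integral_map hZ.aemeasurable hint'.integral_prod_right.aestronglyMeasurable

/-- If `Y` is mean-independent of `(T, Z)` given `(V, x(Z))` and `V` is independent of `Z`, then
`E[Y·T]` is the integral of the product of the two response functions. -/
theorem integral_mul_eq_integral_response {Ω 𝓥 𝓩 𝓧 : Type*} {𝓖 : MeasurableSpace Ω}
    [mΩ : MeasurableSpace Ω] [MeasurableSpace 𝓥] [MeasurableSpace 𝓩] [MeasurableSpace 𝓧]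
    {P : Measure Ω} [IsProbabilityMeasure P] {x : 𝓩 → 𝓧} (hx : Measurable x)
    {Z : Ω → 𝓩} (hZ : Measurable Z) {V : Ω → 𝓥} (hV : Measurable V) (hVZ : IndepFun V Z P)
    (h𝓖 : 𝓖 ≤ mΩ) {T Y : Ω → ℝ} (hT : Measurable[𝓖] T) {B C : ℝ} (hTB : ∀ ω, |T ω| ≤ B)
    (hY : Measurable Y) (hYC : ∀ ω, |Y ω| ≤ C) {m : 𝓥 → 𝓧 → ℝ} {t : 𝓥 → 𝓩 → ℝ}
    (hm : Measurable (Function.uncurry m)) (ht : Measurable (Function.uncurry t))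
    (hYm : P[Y|𝓖] =ᵐ[P] fun ω => m (V ω) (x (Z ω)))
    (hTt : P[T|MeasurableSpace.comap (fun ω => (V ω, Z ω)) inferInstance]
      =ᵐ[P] fun ω => t (V ω) (Z ω)) :
    ∫ ω, Y ω * T ω ∂P = ∫ ω, ∫ v, m v (x (Z ω)) * t v (Z ω) ∂(P.map V) ∂P := by
  have hTm : Measurable T := hT.mono h𝓖 le_rfl
  have hYi : Integrable Y P := .of_bound hY.aestronglyMeasurable C (.of_forall hYC)
  have hTi : Integrable T P := .of_bound hTm.aestronglyMeasurable B (.of_forall hTB)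
  have hmx : Measurable (Function.uncurry fun v z => m v (x z)) :=
    hm.comp (measurable_fst.prodMk (hx.comp measurable_snd))
  have hM : Measurable fun ω => m (V ω) (x (Z ω)) := hm.comp (hV.prodMk (hx.comp hZ))
  have hMC : ∀ᵐ ω ∂P, ‖m (V ω) (x (Z ω))‖ ≤ C := by
    have h := ae_bdd_abs_condExp_of_ae_bdd_abs (m := 𝓖) (μ := P) (.of_forall hYC)
    filter_upwards [h, hYm] with ω h1 h2
    rwa [← h2]
  have hTM : Integrable (T * fun ω => m (V ω) (x (Z ω))) P :=
    hTi.mul_bdd hM.aestronglyMeasurable hMC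
  have hti : Integrable (fun ω => t (V ω) (Z ω)) P := integrable_condExp.congr hTt
  have hYT : Integrable (Y * T) P :=
    hYi.mul_bdd hTm.aestronglyMeasurable (.of_forall hTB)
  calc ∫ ω, Y ω * T ω ∂P = ∫ ω, m (V ω) (x (Z ω)) * T ω ∂P :=
        integral_mul_eq_of_condExp_ae_eq h𝓖 hT.stronglyMeasurable hYi hYT hYm
    _ = ∫ ω, T ω * m (V ω) (x (Z ω)) ∂P := by simp_rw [mul_comm]
    _ = ∫ ω, t (V ω) (Z ω) * m (V ω) (x (Z ω)) ∂P :=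
        integral_mul_eq_of_condExp_ae_eq (hV.prodMk hZ).comap_le
          (hmx.comp (comap_measurable _)).stronglyMeasurable hTi hTM hTt
    _ = ∫ ω, m (V ω) (x (Z ω)) * t (V ω) (Z ω) ∂P := by simp_rw [mul_comm]
    _ = ∫ ω, ∫ v, m v (x (Z ω)) * t v (Z ω) ∂(P.map V) ∂P :=
        integral_comp_eq_of_indepFun (f := fun v z => m v (x z) * t v z) hV hZ hVZ
          (hmx.mul ht) (hti.bdd_mul hM.aestronglyMeasurable hMC)

theorem integral_cond_eq_integral_mul_div {Ω : Type*} [MeasurableSpace Ω] {P : Measure Ω}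
    {s : Set Ω} (hs : MeasurableSet s) {T : Ω → ℝ} (hT : ∀ ω, T ω = s.indicator 1 ω) (f : Ω → ℝ) :
    ∫ ω, f ω ∂(P[|s]) = (∫ ω, f ω * T ω ∂P) / (P s).toReal := by
  rw [ProbabilityTheory.cond, integral_smul_measure, ENNReal.toReal_inv, smul_eq_mul,
    div_eq_inv_mul, ← integral_indicator hs]
  congr 2
  ext ω
  by_cases h : ω ∈ s <;> simp [hT, h]

/-- Under Assumption 1, `E[Y_d·D] = E[∫ m_d·m_D dv]` and `E[Y_d·(1-D)] = E[∫ m_d·(1-m_D) dv]`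
for `d = 0, 1`; consequently, if `0 < ℙ(D = 1) < 1`, the ATT and ATU admit the stated
weighted representations. -/
theorem stmt_13
    {Ω : Type*} [MeasurableSpace Ω] (P : Measure Ω) [IsProbabilityMeasure P]
    {𝓩 𝓧 : Type*} [MeasurableSpace 𝓩] [StandardBorelSpace 𝓩]
    [MeasurableSpace 𝓧] [StandardBorelSpace 𝓧]
    (x : 𝓩 → 𝓧) (hx : Measurable x)
    (Z : Ω → 𝓩) (hZ : Measurable Z)
    (K : ℕ) (hK : 1 ≤ K)
    (V : Ω → (Fin K → ℝ)) (hV : Measurable V)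
    (D : Ω → ℝ) (hD : Measurable D) (hD01 : ∀ ω, D ω = 0 ∨ D ω = 1)
    (Y0 Y1 : Ω → ℝ) (hY0 : Measurable Y0) (hY1 : Measurable Y1)
    (yL yU : ℝ) (hy : yL ≤ yU)
    (hbd0 : ∀ ω, Y0 ω ∈ Set.Icc yL yU) (hbd1 : ∀ ω, Y1 ω ∈ Set.Icc yL yU)
    -- Assumption 1 (i)
    (hA10 : P[Y0 | MeasurableSpace.comap (fun ω => (D ω, Z ω, V ω)) inferInstance]
        =ᵐ[P] P[Y0 | MeasurableSpace.comap (fun ω => (x (Z ω), V ω)) inferInstance])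
    (hA11 : P[Y1 | MeasurableSpace.comap (fun ω => (D ω, Z ω, V ω)) inferInstance]
        =ᵐ[P] P[Y1 | MeasurableSpace.comap (fun ω => (x (Z ω), V ω)) inferInstance])
    -- Assumption 1 (ii)
    (hVZ : IndepFun V Z P)
    (hVunif : Measure.map V P = volume.restrict (Set.Icc (0 : Fin K → ℝ) 1))
    -- the marginal treatment response functions and the propensity score
    (m0 m1 : (Fin K → ℝ) → 𝓧 → ℝ) (mD : (Fin K → ℝ) → 𝓩 → ℝ)
    (hm0 : Measurable (Function.uncurry m0))
    (hm1 : Measurable (Function.uncurry m1))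
    (hmD : Measurable (Function.uncurry mD))
    (hm0v : P[Y0 | MeasurableSpace.comap (fun ω => (V ω, x (Z ω))) inferInstance]
        =ᵐ[P] fun ω => m0 (V ω) (x (Z ω)))
    (hm1v : P[Y1 | MeasurableSpace.comap (fun ω => (V ω, x (Z ω))) inferInstance]
        =ᵐ[P] fun ω => m1 (V ω) (x (Z ω)))
    (hmDv : P[D | MeasurableSpace.comap (fun ω => (V ω, Z ω)) inferInstance]
        =ᵐ[P] fun ω => mD (V ω) (Z ω))
    (hD1 : 0 < P {ω | D ω = 1}) (hD1' : P {ω | D ω = 1} < 1) :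
    ((∫ ω, Y1 ω * D ω ∂P)
        = ∫ ω, ∫ v in Set.Icc (0 : Fin K → ℝ) 1,
            m1 v (x (Z ω)) * mD v (Z ω) ∂volume ∂P) ∧
    ((∫ ω, Y0 ω * D ω ∂P)
        = ∫ ω, ∫ v in Set.Icc (0 : Fin K → ℝ) 1,
            m0 v (x (Z ω)) * mD v (Z ω) ∂volume ∂P) ∧
    ((∫ ω, Y1 ω * (1 - D ω) ∂P)
        = ∫ ω, ∫ v in Set.Icc (0 : Fin K → ℝ) 1,
            m1 v (x (Z ω)) * (1 - mD v (Z ω)) ∂volume ∂P) ∧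
    ((∫ ω, Y0 ω * (1 - D ω) ∂P)
        = ∫ ω, ∫ v in Set.Icc (0 : Fin K → ℝ) 1,
            m0 v (x (Z ω)) * (1 - mD v (Z ω)) ∂volume ∂P) ∧
    ((∫ ω, (Y1 ω - Y0 ω) ∂(P[|{ω | D ω = 1}]))
        = (∫ ω, ∫ v in Set.Icc (0 : Fin K → ℝ) 1,
            (m1 v (x (Z ω)) - m0 v (x (Z ω))) * mD v (Z ω) ∂volume ∂P)
          / (P {ω | D ω = 1}).toReal) ∧
    ((∫ ω, (Y1 ω - Y0 ω) ∂(P[|{ω | D ω = 0}]))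
        = (∫ ω, ∫ v in Set.Icc (0 : Fin K → ℝ) 1,
            (m1 v (x (Z ω)) - m0 v (x (Z ω))) * (1 - mD v (Z ω)) ∂volume ∂P)
          / (P {ω | D ω = 0}).toReal) := by
  have hG : MeasurableSpace.comap (fun ω => (D ω, Z ω, V ω)) inferInstance ≤ ‹MeasurableSpace Ω› :=
    (hD.prodMk (hZ.prodMk hV)).comap_le
  have hDG : Measurable[MeasurableSpace.comap (fun ω => (D ω, Z ω, V ω)) inferInstance] D :=
    measurable_fst.comp (comap_measurable _)
  have hswap : MeasurableSpace.comap (fun ω => (x (Z ω), V ω)) inferInstance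
      = MeasurableSpace.comap (fun ω => (V ω, x (Z ω))) inferInstance :=
    le_antisymm (measurable_swap.comp (comap_measurable fun ω => (V ω, x (Z ω)))).comap_le
      (measurable_swap.comp (comap_measurable fun ω => (x (Z ω), V ω))).comap_le
  rw [hswap] at hA10 hA11
  have h0 := hA10.trans hm0v
  have h1 := hA11.trans hm1v
  have hb0 : ∀ ω, |Y0 ω| ≤ max |yL| |yU| := fun ω => abs_le_max_abs_abs (hbd0 ω).1 (hbd0 ω).2
  have hb1 : ∀ ω, |Y1 ω| ≤ max |yL| |yU| := fun ω => abs_le_max_abs_abs (hbd1 ω).1 (hbd1 ω).2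
  have hi0 : Integrable Y0 P := .of_bound hY0.aestronglyMeasurable _ (.of_forall hb0)
  have hi1 : Integrable Y1 P := .of_bound hY1.aestronglyMeasurable _ (.of_forall hb1)
  have hDb : ∀ ω, |D ω| ≤ 1 := fun ω => by rcases hD01 ω with h | h <;> simp [h]
  have hDb' : ∀ ω, |1 - D ω| ≤ 1 := fun ω => by rcases hD01 ω with h | h <;> simp [h]
  have hDi : Integrable D P := .of_bound hD.aestronglyMeasurable _ (.of_forall hDb)
  have hbd : ∀ ω, |Y1 ω - Y0 ω| ≤ max |yL| |yU| + max |yL| |yU| := fun ω =>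
    (abs_sub _ _).trans (add_le_add (hb1 ω) (hb0 ω))
  have hdiff : P[fun ω => Y1 ω - Y0 ω|
      MeasurableSpace.comap (fun ω => (D ω, Z ω, V ω)) inferInstance]
      =ᵐ[P] fun ω => m1 (V ω) (x (Z ω)) - m0 (V ω) (x (Z ω)) :=
    (condExp_sub hi1 hi0 _).trans (h1.sub h0)
  have hDG' : Measurable[MeasurableSpace.comap (fun ω => (D ω, Z ω, V ω)) inferInstance]
      fun ω => 1 - D ω := hDG.const_sub 1
  have hDt' : P[fun ω => 1 - D ω|MeasurableSpace.comap (fun ω => (V ω, Z ω)) inferInstance]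
      =ᵐ[P] fun ω => 1 - mD (V ω) (Z ω) := by
    refine (condExp_sub (integrable_const (1 : ℝ)) hDi _).trans ?_
    rw [condExp_const (hV.prodMk hZ).comap_le]
    exact (Filter.EventuallyEq.refl _ _).sub hmDv
  have hmD' : Measurable (Function.uncurry fun v z => 1 - mD v z) := hmD.const_sub 1
  rw [← hVunif]
  refine ⟨?_, ?_, ?_, ?_, ?_, ?_⟩
  · exact integral_mul_eq_integral_response hx hZ hV hVZ hG hDG hDb hY1 hb1 hm1 hmD h1 hmDv
  · exact integral_mul_eq_integral_response hx hZ hV hVZ hG hDG hDb hY0 hb0 hm0 hmD h0 hmDv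
  · exact integral_mul_eq_integral_response hx hZ hV hVZ hG hDG' hDb' hY1 hb1 hm1 hmD' h1 hDt'
  · exact integral_mul_eq_integral_response hx hZ hV hVZ hG hDG' hDb' hY0 hb0 hm0 hmD' h0 hDt'
  · rw [integral_cond_eq_integral_mul_div (T := D) (s := {ω | D ω = 1})
        (hD (measurableSet_singleton 1)),
      integral_mul_eq_integral_response (Y := fun ω => Y1 ω - Y0 ω)
        (m := fun v y => m1 v y - m0 v y) hx hZ hV hVZ hG hDG hDb
        (hY1.sub hY0) hbd (hm1.sub hm0) hmD hdiff hmDv]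
    intro ω
    rcases hD01 ω with h | h <;> simp [h]
  · rw [integral_cond_eq_integral_mul_div (T := fun ω => 1 - D ω)
        (s := {ω | D ω = 0})
        (hD (measurableSet_singleton 0)),
      integral_mul_eq_integral_response (Y := fun ω => Y1 ω - Y0 ω)
        (m := fun v y => m1 v y - m0 v y) hx hZ hV hVZ hG hDG'
        hDb' (hY1.sub hY0) hbd (hm1.sub hm0) hmD' hdiff hDt']
    intro ω
    rcases hD01 ω with h | h <;> simp [h]
end

section
/- Suppose K = 1, so V takes values in [0,1]. Under Assumption 1, for all 0 ≤ v̲ < v̄ ≤ 1 and d = 0,1: E[Y_d·1{v̲ ≤ V ≤ v̄}] = E[1{v̲ ≤ V ≤ v̄}·m_d(V, X)] = E[∫_0^1 1{v̲ ≤ v ≤ v̄}·m_d(v, X) dv]; consequently the generalized local average treatment effect satisfies E[Y_1 − Y_0 | v̲ ≤ V ≤ v̄] = E[∫_0^1 (1{v̲ ≤ v ≤ v̄}/(v̄ − v̲))·(m_1(v, X) − m_0(v, X)) dv]. -/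
open MeasureTheory ProbabilityTheory

/-- Fubini for a function of an independent pair `(V, W)`, with `V` distributed as `ν`. -/
theorem integral_comp_indepFun_pair {Ω α β : Type*} [MeasurableSpace Ω] [MeasurableSpace α]
    [MeasurableSpace β] {P : Measure Ω} [IsProbabilityMeasure P] {V : Ω → α} {W : Ω → β}
    (hV : Measurable V) (hW : Measurable W) (hVW : IndepFun V W P) {ν : Measure α}
    (hν : Measure.map V P = ν) {g : α × β → ℝ} (hg : Measurable g)
    (hint : Integrable (fun ω => g (V ω, W ω)) P) :
    ∫ ω, g (V ω, W ω) ∂P = ∫ ω, ∫ v, g (v, W ω) ∂ν ∂P := by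
  subst hν
  have := Measure.isProbabilityMeasure_map (μ := P) hV.aemeasurable
  have := Measure.isProbabilityMeasure_map (μ := P) hW.aemeasurable
  have hmap := (indepFun_iff_map_prod_eq_prod_map_map hV.aemeasurable hW.aemeasurable).1 hVW
  have hgi : Integrable g ((Measure.map V P).prod (Measure.map W P)) := by
    rw [← hmap, integrable_map_measure hg.aestronglyMeasurable (hV.prodMk hW).aemeasurable]
    exact hint
  rw [← integral_map (f := g) (hV.prodMk hW).aemeasurable hg.aestronglyMeasurable, hmap,
    integral_prod_symm g hgi, integral_map hW.aemeasurable]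
  exact hg.stronglyMeasurable.integral_prod_left'.aestronglyMeasurable

/-- If `m (V, W)` is a version of `E[Y | V, W]`, then `Y` and `m (V, W)` have the same integral
over events determined by `V`. -/
theorem integral_indicator_eq_of_condExp_pair {Ω α β : Type*} [MeasurableSpace Ω]
    [MeasurableSpace α] [MeasurableSpace β] {P : Measure Ω} [IsProbabilityMeasure P]
    {V : Ω → α} {W : Ω → β} (hV : Measurable V) (hW : Measurable W)
    {Y : Ω → ℝ} (hY : Integrable Y P) {m : α → β → ℝ}
    (hm : P[Y | MeasurableSpace.comap (fun ω => (V ω, W ω)) inferInstance]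
      =ᵐ[P] fun ω => m (V ω) (W ω)) {s : Set α} (hs : MeasurableSet s) :
    ∫ ω, Set.indicator (V ⁻¹' s) Y ω ∂P
      = ∫ ω, Set.indicator (V ⁻¹' s) (fun ω' => m (V ω') (W ω')) ω ∂P := by
  have hle := (hV.prodMk hW).comap_le
  rw [integral_indicator (hV hs), integral_indicator (hV hs), ← setIntegral_condExp hle hY]
  · exact integral_congr_ae (ae_restrict_of_ae hm)
  · exact ⟨Prod.fst ⁻¹' s, measurable_fst hs, rfl⟩

/-- Under Assumption 1 with scalar unobserved heterogeneity `V ∈ [0,1]`, for any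
`0 ≤ v̲ < v̄ ≤ 1` the truncated moments of the potential outcomes admit the stated
representations, and the generalized local average treatment effect
`E[Y₁ - Y₀ | v̲ ≤ V ≤ v̄]` equals its weighted representation. -/
theorem stmt_14
    {Ω : Type*} [MeasurableSpace Ω] (P : Measure Ω) [IsProbabilityMeasure P]
    {𝓩 𝓧 : Type*} [MeasurableSpace 𝓩] [StandardBorelSpace 𝓩]
    [MeasurableSpace 𝓧] [StandardBorelSpace 𝓧]
    (x : 𝓩 → 𝓧) (hx : Measurable x)
    (Z : Ω → 𝓩) (hZ : Measurable Z)
    (V : Ω → ℝ) (hV : Measurable V)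
    (D : Ω → ℝ) (hD : Measurable D) (hD01 : ∀ ω, D ω = 0 ∨ D ω = 1)
    (Y0 Y1 : Ω → ℝ) (hY0 : Measurable Y0) (hY1 : Measurable Y1)
    (yL yU : ℝ) (hy : yL ≤ yU)
    (hbd0 : ∀ ω, Y0 ω ∈ Set.Icc yL yU) (hbd1 : ∀ ω, Y1 ω ∈ Set.Icc yL yU)
    -- Assumption 1 (i)
    (hA10 : P[Y0 | MeasurableSpace.comap (fun ω => (D ω, Z ω, V ω)) inferInstance]
        =ᵐ[P] P[Y0 | MeasurableSpace.comap (fun ω => (x (Z ω), V ω)) inferInstance])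
    (hA11 : P[Y1 | MeasurableSpace.comap (fun ω => (D ω, Z ω, V ω)) inferInstance]
        =ᵐ[P] P[Y1 | MeasurableSpace.comap (fun ω => (x (Z ω), V ω)) inferInstance])
    -- Assumption 1 (ii)
    (hVZ : IndepFun V Z P)
    (hVunif : Measure.map V P = volume.restrict (Set.Icc (0 : ℝ) 1))
    -- the marginal treatment response functions and the propensity score
    (m0 m1 : ℝ → 𝓧 → ℝ) (mD : ℝ → 𝓩 → ℝ)
    (hm0 : Measurable (Function.uncurry m0))
    (hm1 : Measurable (Function.uncurry m1))
    (hmD : Measurable (Function.uncurry mD))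
    (hm0v : P[Y0 | MeasurableSpace.comap (fun ω => (V ω, x (Z ω))) inferInstance]
        =ᵐ[P] fun ω => m0 (V ω) (x (Z ω)))
    (hm1v : P[Y1 | MeasurableSpace.comap (fun ω => (V ω, x (Z ω))) inferInstance]
        =ᵐ[P] fun ω => m1 (V ω) (x (Z ω)))
    (hmDv : P[D | MeasurableSpace.comap (fun ω => (V ω, Z ω)) inferInstance]
        =ᵐ[P] fun ω => mD (V ω) (Z ω))
    -- the thresholds
    (vl vu : ℝ) (hvl : 0 ≤ vl) (hvlu : vl < vu) (hvu : vu ≤ 1) :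
    ((∫ ω, Set.indicator {ω' | vl ≤ V ω' ∧ V ω' ≤ vu} Y0 ω ∂P)
        = ∫ ω, Set.indicator {ω' | vl ≤ V ω' ∧ V ω' ≤ vu}
            (fun ω' => m0 (V ω') (x (Z ω'))) ω ∂P) ∧
    ((∫ ω, Set.indicator {ω' | vl ≤ V ω' ∧ V ω' ≤ vu} Y0 ω ∂P)
        = ∫ ω, ∫ v in Set.Icc (0 : ℝ) 1,
            Set.indicator {v' | vl ≤ v' ∧ v' ≤ vu} (fun v' => m0 v' (x (Z ω))) v
              ∂volume ∂P) ∧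
    ((∫ ω, Set.indicator {ω' | vl ≤ V ω' ∧ V ω' ≤ vu} Y1 ω ∂P)
        = ∫ ω, Set.indicator {ω' | vl ≤ V ω' ∧ V ω' ≤ vu}
            (fun ω' => m1 (V ω') (x (Z ω'))) ω ∂P) ∧
    ((∫ ω, Set.indicator {ω' | vl ≤ V ω' ∧ V ω' ≤ vu} Y1 ω ∂P)
        = ∫ ω, ∫ v in Set.Icc (0 : ℝ) 1,
            Set.indicator {v' | vl ≤ v' ∧ v' ≤ vu} (fun v' => m1 v' (x (Z ω))) v
              ∂volume ∂P) ∧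
    -- the generalized local average treatment effect
    ((∫ ω, (Y1 ω - Y0 ω) ∂(P[|{ω | vl ≤ V ω ∧ V ω ≤ vu}]))
        = ∫ ω, ∫ v in Set.Icc (0 : ℝ) 1,
            (Set.indicator {v' | vl ≤ v' ∧ v' ≤ vu} (fun _ => (1 : ℝ)) v / (vu - vl))
              * (m1 v (x (Z ω)) - m0 v (x (Z ω))) ∂volume ∂P) := by
  have hW : Measurable fun ω => x (Z ω) := hx.comp hZ
  have hVW : IndepFun V (fun ω => x (Z ω)) P := hVZ.comp measurable_id hx
  have hs : MeasurableSet (Set.Icc vl vu) := measurableSet_Icc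
  have hS : MeasurableSet {ω | vl ≤ V ω ∧ V ω ≤ vu} := hV hs
  have hY0i : Integrable Y0 P := Integrable.of_mem_Icc yL yU hY0.aemeasurable (.of_forall hbd0)
  have hY1i : Integrable Y1 P := Integrable.of_mem_Icc yL yU hY1.aemeasurable (.of_forall hbd1)
  have hm0i : Integrable (fun ω => m0 (V ω) (x (Z ω))) P := integrable_condExp.congr hm0v
  have hm1i : Integrable (fun ω => m1 (V ω) (x (Z ω))) P := integrable_condExp.congr hm1v
  have h0 := integral_indicator_eq_of_condExp_pair hV hW hY0i hm0v hs
  have h1 := integral_indicator_eq_of_condExp_pair hV hW hY1i hm1v hs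
  have key0 := integral_comp_indepFun_pair hV hW hVW hVunif
    (hm0.indicator (measurable_fst hs)) (hm0i.indicator hS)
  have key1 := integral_comp_indepFun_pair hV hW hVW hVunif
    (hm1.indicator (measurable_fst hs)) (hm1i.indicator hS)
  refine ⟨h0, h0.trans key0, h1, h1.trans key1, ?_⟩
  have hPS : P {ω | vl ≤ V ω ∧ V ω ≤ vu} = ENNReal.ofReal (vu - vl) := by
    change P (V ⁻¹' Set.Icc vl vu) = _
    rw [← Measure.map_apply hV hs, hVunif, Measure.restrict_apply hs,
      Set.inter_eq_left.2 (Set.Icc_subset_Icc hvl hvu), Real.volume_Icc]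
  let g : ℝ × 𝓧 → ℝ := fun p =>
    (Set.indicator {v' | vl ≤ v' ∧ v' ≤ vu} (fun _ => (1 : ℝ)) p.1 / (vu - vl))
      * (m1 p.1 p.2 - m0 p.1 p.2)
  have hg : Measurable g :=
    (((measurable_const.indicator hs).comp measurable_fst).div_const _).mul (hm1.sub hm0)
  have hgV : (fun ω => g (V ω, x (Z ω))) = fun ω => (vu - vl)⁻¹ *
      (Set.indicator {ω' | vl ≤ V ω' ∧ V ω' ≤ vu} (fun ω' => m1 (V ω') (x (Z ω'))) ω
        - Set.indicator {ω' | vl ≤ V ω' ∧ V ω' ≤ vu} (fun ω' => m0 (V ω') (x (Z ω'))) ω) := by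
    funext ω
    by_cases h : vl ≤ V ω ∧ V ω ≤ vu
    · simp [g, h]
    · simp [g, h]
  have hgi : Integrable (fun ω => g (V ω, x (Z ω))) P := by
    rw [hgV]
    exact ((hm1i.indicator hS).sub (hm0i.indicator hS)).const_mul _
  have hfub := integral_comp_indepFun_pair hV hW hVW hVunif hg hgi
  refine Eq.trans ?_ hfub
  rw [hgV, integral_const_mul, integral_sub (hm1i.indicator hS) (hm0i.indicator hS)]
  erw [← h0, ← h1]
  rw [ProbabilityTheory.cond, integral_smul_measure, hPS, integral_sub hY1i.integrableOn
    hY0i.integrableOn, ← integral_indicator hS, ← integral_indicator hS, ENNReal.toReal_inv,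
    ENNReal.toReal_ofReal (sub_nonneg.2 hvlu.le), smul_eq_mul]
  rfl
end

section
/- Under Assumption 1, let x0 ∈ 𝒳 satisfy ℙ(X = x0, D = 1) > 0 and ℙ(X = x0, D = 0) > 0. Then E[Y_1·(1−D)·1{X = x0}] = E[1{X = x0}·∫ m_1(v, x0)·(1 − m_D(v, Z)) dv] and E[Y_0·D·1{X = x0}] = E[1{X = x0}·∫ m_0(v, x0)·m_D(v, Z) dv]. Consequently, if the monotone treatment selection condition E[Y_d | X = x0, D = 1] ≥ E[Y_d | X = x0, D = 0] holds for d = 0,1 (conditional expectations given the positive-probability events), then E[Y | X = x0, D = 1]·ℙ(D = 0 | X = x0) ≥ E[1{X = x0}·∫ m_1(v, x0)·(1 − m_D(v, Z)) dv] / ℙ(X = x0) and E[Y | X = x0, D = 0]·ℙ(D = 1 | X = x0) ≤ E[1{X = x0}·∫ m_0(v, x0)·m_D(v, Z) dv] / ℙ(X = x0). -/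
open MeasureTheory ProbabilityTheory

/-- The defining pull-out identity of the conditional expectation, in integrated form. -/
theorem integral_mul_condExp_of_stronglyMeasurable {Ω : Type*} {m m₀ : MeasurableSpace Ω}
    {P : Measure Ω} [IsFiniteMeasure P] (hm : m ≤ m₀) {f g : Ω → ℝ}
    (hf : StronglyMeasurable[m] f) (hfg : Integrable (f * g) P) (hg : Integrable g P) :
    ∫ ω, f ω * g ω ∂P = ∫ ω, f ω * (P[g | m]) ω ∂P := by
  have h1 : ∫ ω, (P[f * g | m]) ω ∂P = ∫ ω, (f * g) ω ∂P := integral_condExp hm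
  have h2 : P[f * g | m] =ᵐ[P] f * P[g | m] := condExp_mul_of_stronglyMeasurable_left hf hfg hg
  rw [integral_congr_ae h2] at h1
  exact h1.symm

/-- If `Y` is mean independent of the treatment `D` and the instrument `Z` given the
heterogeneity `V` and the covariates `x (Z)`, and `V` is independent of `Z`, then the moment of
`Y` times a bounded function `q (D)` on `{x (Z) = x0}` is obtained by integrating out `V`. -/
theorem integral_indicator_mul_eq_integral_indicator_setIntegral
    {Ω : Type*} [MeasurableSpace Ω] {P : Measure Ω} [IsProbabilityMeasure P]
    {𝓩 𝓧 𝓥 : Type*} [MeasurableSpace 𝓩] [MeasurableSpace 𝓧] [MeasurableSingletonClass 𝓧]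
    [MeasurableSpace 𝓥] {ν : Measure 𝓥}
    {x : 𝓩 → 𝓧} (hx : Measurable x) {Z : Ω → 𝓩} (hZ : Measurable Z)
    {V : Ω → 𝓥} (hV : Measurable V) {D : Ω → ℝ} (hD : Measurable D)
    {Y : Ω → ℝ} (hY : Measurable Y) {C : ℝ} (hYC : ∀ ω, |Y ω| ≤ C)
    {q : ℝ → ℝ} (hq : Measurable q) {B : ℝ} (hqB : ∀ ω, |q (D ω)| ≤ B)
    (hmean : P[Y | MeasurableSpace.comap (fun ω => (D ω, Z ω, V ω)) inferInstance]
        =ᵐ[P] P[Y | MeasurableSpace.comap (fun ω => (x (Z ω), V ω)) inferInstance])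
    (hVZ : IndepFun V Z P) (hVν : Measure.map V P = ν)
    {m : 𝓥 → 𝓧 → ℝ} {w : 𝓥 → 𝓩 → ℝ}
    (hm : Measurable (Function.uncurry m)) (hw : Measurable (Function.uncurry w))
    (hmY : P[Y | MeasurableSpace.comap (fun ω => (V ω, x (Z ω))) inferInstance]
        =ᵐ[P] fun ω => m (V ω) (x (Z ω)))
    (hwD : P[fun ω => q (D ω) | MeasurableSpace.comap (fun ω => (V ω, Z ω)) inferInstance]
        =ᵐ[P] fun ω => w (V ω) (Z ω))
    (x0 : 𝓧) :
    ∫ ω, Set.indicator {ω' | x (Z ω') = x0} (fun ω' => Y ω' * q (D ω')) ω ∂P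
      = ∫ ω, Set.indicator {ω' | x (Z ω') = x0}
          (fun ω' => ∫ v, m v x0 * w v (Z ω') ∂ν) ω ∂P := by
  have hprob : IsProbabilityMeasure ν := hVν ▸ Measure.isProbabilityMeasure_map hV.aemeasurable
  have hprobZ : IsProbabilityMeasure (Measure.map Z P) :=
    Measure.isProbabilityMeasure_map hZ.aemeasurable
  set T : Set 𝓩 := {z | x z = x0}
  have hTm : MeasurableSet T := hx (measurableSet_singleton x0)
  let s : 𝓩 → ℝ := T.indicator 1
  have hs : Measurable s := measurable_one.indicator hTm
  have hs1 : ∀ z, |s z| ≤ 1 := fun z => by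
    by_cases hz : z ∈ T <;> simp [s, hz]
  have hYi : Integrable Y P :=
    Integrable.of_bound hY.aestronglyMeasurable C (.of_forall hYC)
  have hqm : Measurable fun ω => q (D ω) := hq.comp hD
  have hqi : Integrable (fun ω => q (D ω)) P :=
    Integrable.of_bound hqm.aestronglyMeasurable B (.of_forall hqB)
  have hsZ : Measurable fun ω => s (Z ω) := hs.comp hZ
  have hswap : MeasurableSpace.comap (fun ω => (x (Z ω), V ω)) inferInstance
      = MeasurableSpace.comap (fun ω => (V ω, x (Z ω))) inferInstance := by
    exact (MeasurableSpace.comap_prodMk _ _).trans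
      ((sup_comm _ _).trans (MeasurableSpace.comap_prodMk _ _).symm)
  have hYm : P[Y | MeasurableSpace.comap (fun ω => (D ω, Z ω, V ω)) inferInstance]
      =ᵐ[P] fun ω => m (V ω) (x (Z ω)) := by
    rw [hswap] at hmean
    exact hmean.trans hmY
  have hmm : Measurable fun ω => m (V ω) (x (Z ω)) := hm.comp (hV.prodMk (hx.comp hZ))
  have hmbd : ∀ᵐ ω ∂P, ‖m (V ω) (x (Z ω))‖ ≤ |C| := by
    have h := ae_bdd_abs_condExp_of_ae_bdd_abs (R := |C|) (μ := P) (f := Y)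
      (m := MeasurableSpace.comap (fun ω => (V ω, x (Z ω))) inferInstance)
      (.of_forall fun ω => (hYC ω).trans (le_abs_self C))
    filter_upwards [h, hmY] with ω h1 h2
    rw [← h2]
    exact h1
  have hm_int : Integrable (fun ω => m (V ω) (x (Z ω))) P :=
    Integrable.of_bound hmm.aestronglyMeasurable _ hmbd
  have hw_int : Integrable (fun ω => w (V ω) (Z ω)) P := integrable_condExp.congr hwD
  have hsm_bd : ∀ᵐ ω ∂P, ‖s (Z ω) * m (V ω) (x (Z ω))‖ ≤ |C| := by
    filter_upwards [hmbd] with ω h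
    rw [norm_mul, Real.norm_eq_abs (s _)]
    nlinarith [hs1 (Z ω), norm_nonneg (m (V ω) (x (Z ω))), abs_nonneg (s (Z ω))]
  let g : 𝓥 × 𝓩 → ℝ := fun p => s p.2 * m p.1 (x p.2) * w p.1 p.2
  have hg : Measurable g := by
    have h1 : Measurable fun p : 𝓥 × 𝓩 => m p.1 (x p.2) :=
      hm.comp (measurable_fst.prodMk (hx.comp measurable_snd))
    exact ((hs.comp measurable_snd).mul h1).mul hw
  have hg_int : Integrable (fun ω => g (V ω, Z ω)) P :=
    hw_int.bdd_mul (hsZ.mul hmm).aestronglyMeasurable hsm_bd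
  have hmap : Measure.map (fun ω => (V ω, Z ω)) P = ν.prod (Measure.map Z P) := by
    rw [(indepFun_iff_map_prod_eq_prod_map_map hV.aemeasurable hZ.aemeasurable).1 hVZ, hVν]
  have hg_prod : Integrable g (ν.prod (Measure.map Z P)) := by
    rw [← hmap]
    exact (integrable_map_measure hg.aestronglyMeasurable (hV.prodMk hZ).aemeasurable).2 hg_int
  have hD3 : Measurable[MeasurableSpace.comap (fun ω => (D ω, Z ω, V ω)) inferInstance]
      fun ω => (D ω, Z ω, V ω) := comap_measurable _
  have hV2 : Measurable[MeasurableSpace.comap (fun ω => (V ω, Z ω)) inferInstance]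
      fun ω => (V ω, Z ω) := comap_measurable _
  calc ∫ ω, Set.indicator {ω' | x (Z ω') = x0} (fun ω' => Y ω' * q (D ω')) ω ∂P
      = ∫ ω, (s (Z ω) * q (D ω)) * Y ω ∂P := by
        refine integral_congr_ae (.of_forall fun ω => ?_)
        by_cases h : x (Z ω) = x0 <;> simp [s, T, h, mul_comm]
    _ = ∫ ω, (s (Z ω) * q (D ω)) *
          (P[Y | MeasurableSpace.comap (fun ω => (D ω, Z ω, V ω)) inferInstance]) ω ∂P := by
        refine integral_mul_condExp_of_stronglyMeasurable
          (hD.prodMk (hZ.prodMk hV)).comap_le (Measurable.stronglyMeasurable ?_) ?_ hYi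
        · have h : Measurable fun p : ℝ × 𝓩 × 𝓥 => s p.2.1 * q p.1 :=
            (hs.comp (measurable_fst.comp measurable_snd)).mul (hq.comp measurable_fst)
          exact h.comp hD3
        · refine hYi.bdd_mul (c := 1 * B) (hsZ.mul hqm).aestronglyMeasurable
            (.of_forall fun ω => ?_)
          rw [norm_mul]
          exact mul_le_mul (hs1 _) (hqB ω) (norm_nonneg _) zero_le_one
    _ = ∫ ω, (s (Z ω) * m (V ω) (x (Z ω))) * q (D ω) ∂P := by
        refine integral_congr_ae ?_
        filter_upwards [hYm] with ω h
        rw [h]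
        ring
    _ = ∫ ω, (s (Z ω) * m (V ω) (x (Z ω))) * (P[fun ω => q (D ω) |
          MeasurableSpace.comap (fun ω => (V ω, Z ω)) inferInstance]) ω ∂P := by
        refine integral_mul_condExp_of_stronglyMeasurable
          (hV.prodMk hZ).comap_le (Measurable.stronglyMeasurable ?_) ?_ hqi
        · have h : Measurable fun p : 𝓥 × 𝓩 => s p.2 * m p.1 (x p.2) :=
            (hs.comp measurable_snd).mul
              (hm.comp (measurable_fst.prodMk (hx.comp measurable_snd)))
          exact h.comp hV2
        · exact hqi.bdd_mul (hsZ.mul hmm).aestronglyMeasurable hsm_bd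
    _ = ∫ ω, g (V ω, Z ω) ∂P := by
        refine integral_congr_ae ?_
        filter_upwards [hwD] with ω h
        rw [h]
    _ = ∫ p, g p ∂(ν.prod (Measure.map Z P)) := by
        rw [← hmap, integral_map (hV.prodMk hZ).aemeasurable hg.aestronglyMeasurable]
    _ = ∫ z, ∫ v, g (v, z) ∂ν ∂(Measure.map Z P) := integral_prod_symm g hg_prod
    _ = ∫ ω, ∫ v, g (v, Z ω) ∂ν ∂P :=
        integral_map hZ.aemeasurable hg_prod.integral_prod_right.aestronglyMeasurable
    _ = _ := by
        refine integral_congr_ae (.of_forall fun ω => ?_)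
        by_cases h : x (Z ω) = x0 <;> simp [g, s, T, h]

/-- Integral with respect to the conditional probability given an event. -/
theorem integral_cond_eq {Ω : Type*} [MeasurableSpace Ω] (P : Measure Ω) (A : Set Ω)
    (f : Ω → ℝ) : ∫ ω, f ω ∂(P[|A]) = (P.real A)⁻¹ * ∫ ω in A, f ω ∂P := by
  rw [ProbabilityTheory.cond, integral_smul_measure, ENNReal.toReal_inv, smul_eq_mul, Measure.real]

/-- On an event `S ⊇ A`, the conditional probability of `A` times the conditional mean given `A`
is the normalized integral over `A`. -/
theorem integral_cond_mul_cond_toReal {Ω : Type*} [MeasurableSpace Ω] (P : Measure Ω)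
    [IsFiniteMeasure P] {S E : Set Ω} (hS : MeasurableSet S) (hSE : 0 < P (S ∩ E)) (f : Ω → ℝ) :
    (∫ ω, f ω ∂(P[|S ∩ E])) * ((P[|S]) E).toReal = (∫ ω in S ∩ E, f ω ∂P) / (P S).toReal := by
  have h0 : P.real (S ∩ E) ≠ 0 := (ENNReal.toReal_pos hSE.ne' (measure_ne_top _ _)).ne'
  rw [integral_cond_eq, cond_apply hS, ENNReal.toReal_mul, ENNReal.toReal_inv]
  change (P.real (S ∩ E))⁻¹ * _ * ((P S).toReal⁻¹ * P.real (S ∩ E)) = _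
  field_simp

/-- Under Assumption 1, the moments `E[Y₁(1-D)1{X=x₀}]` and `E[Y₀·D·1{X=x₀}]` admit the
stated representations; consequently, under monotone treatment selection the two
inequality constraints implied by MTS hold. -/
theorem stmt_15
    {Ω : Type*} [MeasurableSpace Ω] (P : Measure Ω) [IsProbabilityMeasure P]
    {𝓩 𝓧 : Type*} [MeasurableSpace 𝓩] [StandardBorelSpace 𝓩]
    [MeasurableSpace 𝓧] [StandardBorelSpace 𝓧]
    (x : 𝓩 → 𝓧) (hx : Measurable x)
    (Z : Ω → 𝓩) (hZ : Measurable Z)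
    (K : ℕ) (hK : 1 ≤ K)
    (V : Ω → (Fin K → ℝ)) (hV : Measurable V)
    (D : Ω → ℝ) (hD : Measurable D) (hD01 : ∀ ω, D ω = 0 ∨ D ω = 1)
    (Y0 Y1 : Ω → ℝ) (hY0 : Measurable Y0) (hY1 : Measurable Y1)
    (yL yU : ℝ) (hy : yL ≤ yU)
    (hbd0 : ∀ ω, Y0 ω ∈ Set.Icc yL yU) (hbd1 : ∀ ω, Y1 ω ∈ Set.Icc yL yU)
    -- Assumption 1 (i)
    (hA10 : P[Y0 | MeasurableSpace.comap (fun ω => (D ω, Z ω, V ω)) inferInstance]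
        =ᵐ[P] P[Y0 | MeasurableSpace.comap (fun ω => (x (Z ω), V ω)) inferInstance])
    (hA11 : P[Y1 | MeasurableSpace.comap (fun ω => (D ω, Z ω, V ω)) inferInstance]
        =ᵐ[P] P[Y1 | MeasurableSpace.comap (fun ω => (x (Z ω), V ω)) inferInstance])
    -- Assumption 1 (ii)
    (hVZ : IndepFun V Z P)
    (hVunif : Measure.map V P = volume.restrict (Set.Icc (0 : Fin K → ℝ) 1))
    -- the marginal treatment response functions and the propensity score
    (m0 m1 : (Fin K → ℝ) → 𝓧 → ℝ) (mD : (Fin K → ℝ) → 𝓩 → ℝ)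
    (hm0 : Measurable (Function.uncurry m0))
    (hm1 : Measurable (Function.uncurry m1))
    (hmD : Measurable (Function.uncurry mD))
    (hm0v : P[Y0 | MeasurableSpace.comap (fun ω => (V ω, x (Z ω))) inferInstance]
        =ᵐ[P] fun ω => m0 (V ω) (x (Z ω)))
    (hm1v : P[Y1 | MeasurableSpace.comap (fun ω => (V ω, x (Z ω))) inferInstance]
        =ᵐ[P] fun ω => m1 (V ω) (x (Z ω)))
    (hmDv : P[D | MeasurableSpace.comap (fun ω => (V ω, Z ω)) inferInstance]
        =ᵐ[P] fun ω => mD (V ω) (Z ω))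
    (x0 : 𝓧)
    (hA1 : 0 < P {ω | x (Z ω) = x0 ∧ D ω = 1})
    (hA0 : 0 < P {ω | x (Z ω) = x0 ∧ D ω = 0}) :
    ((∫ ω, Set.indicator {ω' | x (Z ω') = x0} (fun ω' => Y1 ω' * (1 - D ω')) ω ∂P)
        = ∫ ω, Set.indicator {ω' | x (Z ω') = x0}
            (fun ω' => ∫ v in Set.Icc (0 : Fin K → ℝ) 1,
              m1 v x0 * (1 - mD v (Z ω')) ∂volume) ω ∂P) ∧
    ((∫ ω, Set.indicator {ω' | x (Z ω') = x0} (fun ω' => Y0 ω' * D ω') ω ∂P)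
        = ∫ ω, Set.indicator {ω' | x (Z ω') = x0}
            (fun ω' => ∫ v in Set.Icc (0 : Fin K → ℝ) 1,
              m0 v x0 * mD v (Z ω') ∂volume) ω ∂P) ∧
    -- consequence under monotone treatment selection
    (((∫ ω, Y0 ω ∂(P[|{ω | x (Z ω) = x0 ∧ D ω = 1}]))
        ≥ ∫ ω, Y0 ω ∂(P[|{ω | x (Z ω) = x0 ∧ D ω = 0}])) →
     ((∫ ω, Y1 ω ∂(P[|{ω | x (Z ω) = x0 ∧ D ω = 1}]))
        ≥ ∫ ω, Y1 ω ∂(P[|{ω | x (Z ω) = x0 ∧ D ω = 0}])) →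
      ((∫ ω, (D ω * Y1 ω + (1 - D ω) * Y0 ω) ∂(P[|{ω | x (Z ω) = x0 ∧ D ω = 1}]))
          * ((P[|{ω | x (Z ω) = x0}]) {ω | D ω = 0}).toReal
        ≥ (∫ ω, Set.indicator {ω' | x (Z ω') = x0}
            (fun ω' => ∫ v in Set.Icc (0 : Fin K → ℝ) 1,
              m1 v x0 * (1 - mD v (Z ω')) ∂volume) ω ∂P)
          / (P {ω | x (Z ω) = x0}).toReal) ∧
      ((∫ ω, (D ω * Y1 ω + (1 - D ω) * Y0 ω) ∂(P[|{ω | x (Z ω) = x0 ∧ D ω = 0}]))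
          * ((P[|{ω | x (Z ω) = x0}]) {ω | D ω = 1}).toReal
        ≤ (∫ ω, Set.indicator {ω' | x (Z ω') = x0}
            (fun ω' => ∫ v in Set.Icc (0 : Fin K → ℝ) 1,
              m0 v x0 * mD v (Z ω') ∂volume) ω ∂P)
          / (P {ω | x (Z ω) = x0}).toReal)) := by
  have hbd : ∀ {Y : Ω → ℝ}, (∀ ω, Y ω ∈ Set.Icc yL yU) → ∀ ω, |Y ω| ≤ max |yL| |yU| :=
    fun h ω => abs_le_max_abs_abs (h ω).1 (h ω).2
  have hDi : Integrable D P := Integrable.of_bound hD.aestronglyMeasurable 1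
    (.of_forall fun ω => by rcases hD01 ω with h | h <;> simp [h])
  have hcompl : P[fun ω => 1 - D ω | MeasurableSpace.comap (fun ω => (V ω, Z ω)) inferInstance]
      =ᵐ[P] fun ω => 1 - mD (V ω) (Z ω) := by
    have h1 := condExp_sub (integrable_const (1 : ℝ)) hDi
      (MeasurableSpace.comap (fun ω => (V ω, Z ω)) inferInstance)
    rw [condExp_const (hV.prodMk hZ).comap_le] at h1
    refine Filter.EventuallyEq.trans (g := (fun _ => (1 : ℝ)) - P[D |
      MeasurableSpace.comap (fun ω => (V ω, Z ω)) inferInstance]) h1 ?_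
    filter_upwards [hmDv] with ω h
    simp [h]
  have e1 := integral_indicator_mul_eq_integral_indicator_setIntegral hx hZ hV hD hY1 (hbd hbd1)
    (q := fun t => 1 - t) (measurable_const.sub measurable_id) (B := 1)
    (fun ω => by rcases hD01 ω with h | h <;> simp [h]) hA11 hVZ hVunif hm1
    (w := fun v z => 1 - mD v z) (Measurable.sub (f := fun _ => 1) measurable_const hmD) hm1v hcompl x0
  have e0 := integral_indicator_mul_eq_integral_indicator_setIntegral hx hZ hV hD hY0 (hbd hbd0)
    (q := fun t => t) measurable_id (B := 1)
    (fun ω => by rcases hD01 ω with h | h <;> simp [h]) hA10 hVZ hVunif hm0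
    (w := mD) hmD hm0v hmDv x0
  refine ⟨e1, e0, fun hmts0 hmts1 => ?_⟩
  rw [← e1, ← e0]
  have hS : MeasurableSet {ω | x (Z ω) = x0} := (hx.comp hZ) (measurableSet_singleton x0)
  have hE : ∀ d : ℝ, MeasurableSet {ω | D ω = d} := fun d => hD (measurableSet_singleton d)
  have hSE : ∀ d : ℝ, {ω | x (Z ω) = x0 ∧ D ω = d} = {ω | x (Z ω) = x0} ∩ {ω | D ω = d} :=
    fun d => rfl
  simp only [hSE] at hmts0 hmts1 hA0 hA1 ⊢
  have o1 : ∫ ω, (D ω * Y1 ω + (1 - D ω) * Y0 ω) ∂(P[|{ω | x (Z ω) = x0} ∩ {ω | D ω = 1}])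
      = ∫ ω, Y1 ω ∂(P[|{ω | x (Z ω) = x0} ∩ {ω | D ω = 1}]) := by
    refine integral_congr_ae ?_
    filter_upwards [ae_cond_mem (hS.inter (hE 1))] with ω h
    have h' : D ω = 1 := h.2
    simp [h']
  have o0 : ∫ ω, (D ω * Y1 ω + (1 - D ω) * Y0 ω) ∂(P[|{ω | x (Z ω) = x0} ∩ {ω | D ω = 0}])
      = ∫ ω, Y0 ω ∂(P[|{ω | x (Z ω) = x0} ∩ {ω | D ω = 0}]) := by
    refine integral_congr_ae ?_
    filter_upwards [ae_cond_mem (hS.inter (hE 0))] with ω h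
    have h' : D ω = 0 := h.2
    simp [h']
  have r1 : ∫ ω, Set.indicator {ω' | x (Z ω') = x0} (fun ω' => Y1 ω' * (1 - D ω')) ω ∂P
      = ∫ ω in {ω | x (Z ω) = x0} ∩ {ω | D ω = 0}, Y1 ω ∂P := by
    rw [← integral_indicator (hS.inter (hE 0))]
    refine integral_congr_ae (.of_forall fun ω => ?_)
    by_cases h : x (Z ω) = x0 <;> rcases hD01 ω with h' | h' <;> simp [Set.indicator, h, h']
  have r0 : ∫ ω, Set.indicator {ω' | x (Z ω') = x0} (fun ω' => Y0 ω' * D ω') ω ∂P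
      = ∫ ω in {ω | x (Z ω) = x0} ∩ {ω | D ω = 1}, Y0 ω ∂P := by
    rw [← integral_indicator (hS.inter (hE 1))]
    refine integral_congr_ae (.of_forall fun ω => ?_)
    by_cases h : x (Z ω) = x0 <;> rcases hD01 ω with h' | h' <;> simp [Set.indicator, h, h']
  rw [o1, o0, r1, r0, ← integral_cond_mul_cond_toReal P hS hA0,
    ← integral_cond_mul_cond_toReal P hS hA1]
  exact ⟨mul_le_mul_of_nonneg_right hmts1 ENNReal.toReal_nonneg,
    mul_le_mul_of_nonneg_right hmts0 ENNReal.toReal_nonneg⟩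
end

section
/- E[Y*] = ∫_𝒵 ∫_{[0,1]^K} [ m_0(v, x(z))·(1 − m_D(v, z)) + m_1(v, x(z))·m_D(v, z) ] dv dμ*(z), where μ* is the law of Z* and the inner integral is with respect to Lebesgue measure on [0,1]^K. -/
open MeasureTheory ProbabilityTheory

/-- If a bounded `D` is `m₁`-measurable, `μ[Y | m₁]` has an `m₂`-measurable version `f` with
`m₂ ≤ m₁`, and `q` is a version of `μ[D | m₂]`, then `f * q` is integrable with
integral `∫ D * Y`. -/
theorem integrable_mul_and_integral_mul_eq_of_condExp {Ω : Type*} {m₁ m₂ mΩ : MeasurableSpace Ω}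
    {μ : Measure Ω} [IsFiniteMeasure μ] (h₂₁ : m₂ ≤ m₁) (h₁ : m₁ ≤ mΩ) {D Y f q : Ω → ℝ} {C : ℝ}
    (hD : StronglyMeasurable[m₁] D) (hDC : ∀ ω, ‖D ω‖ ≤ C) (hY : Integrable Y μ)
    (hf : StronglyMeasurable[m₂] f) (hYf : μ[Y | m₁] =ᵐ[μ] f) (hDq : μ[D | m₂] =ᵐ[μ] q) :
    Integrable (f * q) μ ∧ ∫ ω, (D * Y) ω ∂μ = ∫ ω, (f * q) ω ∂μ := by
  have hDm : AEStronglyMeasurable D μ := (hD.mono h₁).aestronglyMeasurable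
  have hDi : Integrable D μ := Integrable.of_bound hDm C (ae_of_all _ hDC)
  have hfi : Integrable f μ := integrable_condExp.congr hYf
  have hDY : Integrable (D * Y) μ := hY.bdd_mul hDm (ae_of_all _ hDC)
  have hfD : Integrable (f * D) μ := by
    rw [mul_comm]
    exact hfi.bdd_mul hDm (ae_of_all _ hDC)
  have hcond₁ : μ[D * Y | m₁] =ᵐ[μ] f * D := by
    filter_upwards [condExp_mul_of_stronglyMeasurable_left hD hDY hY, hYf] with ω h h'
    rw [h, Pi.mul_apply, Pi.mul_apply, h', mul_comm]
  have hcond₂ : μ[f * D | m₂] =ᵐ[μ] f * q := by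
    filter_upwards [condExp_mul_of_stronglyMeasurable_left hf hfD hDi, hDq] with ω h h'
    rw [h, Pi.mul_apply, Pi.mul_apply, h']
  refine ⟨integrable_condExp.congr hcond₂, ?_⟩
  rw [← integral_condExp h₁, integral_congr_ae hcond₁, ← integral_condExp (h₂₁.trans h₁),
    integral_congr_ae hcond₂]

/-- The expectation of a function of two independent variables as an iterated integral. -/
theorem integral_comp_eq_integral_integral_of_indepFun {Ω α β : Type*} {mΩ : MeasurableSpace Ω}
    [MeasurableSpace α] [MeasurableSpace β] {μ : Measure Ω} [IsFiniteMeasure μ]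
    {X : Ω → α} {Z : Ω → β} (hX : Measurable X) (hZ : Measurable Z) (h : IndepFun X Z μ)
    {F : α × β → ℝ} (hF : Measurable F) (hint : Integrable (fun ω => F (X ω, Z ω)) μ) :
    ∫ ω, F (X ω, Z ω) ∂μ = ∫ z, ∫ v, F (v, z) ∂(μ.map X) ∂(μ.map Z) := by
  have hXZ : AEMeasurable (fun ω => (X ω, Z ω)) μ := (hX.prodMk hZ).aemeasurable
  have hmap : μ.map (fun ω => (X ω, Z ω)) = (μ.map X).prod (μ.map Z) :=
    (indepFun_iff_map_prod_eq_prod_map_map hX.aemeasurable hZ.aemeasurable).1 h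
  have hF' : Integrable F ((μ.map X).prod (μ.map Z)) := by
    rw [← hmap]
    exact (integrable_map_measure hF.aestronglyMeasurable hXZ).2 hint
  rw [← integral_prod_symm F hF', ← hmap, integral_map hXZ hF.aestronglyMeasurable]

/-- The policy counterfactual mean: under Assumption 1 for `(Y₀, Y₁, D*, Z*, V)`,
`E[Y*] = ∫_𝒵 ∫_{[0,1]^K} [m₀(v, x(z))(1 - m_D(v, z)) + m₁(v, x(z)) m_D(v, z)] dv dμ*(z)`,
where `μ*` is the law of the new policy instrument `Z*`. -/
theorem stmt_16
    {Ω : Type*} [MeasurableSpace Ω] (P : Measure Ω) [IsProbabilityMeasure P]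
    {𝓩 𝓧 : Type*} [MeasurableSpace 𝓩] [StandardBorelSpace 𝓩]
    [MeasurableSpace 𝓧] [StandardBorelSpace 𝓧]
    (x : 𝓩 → 𝓧) (hx : Measurable x)
    (Zstar : Ω → 𝓩) (hZstar : Measurable Zstar)
    (K : ℕ) (hK : 1 ≤ K)
    (V : Ω → (Fin K → ℝ)) (hV : Measurable V)
    (Dstar : Ω → ℝ) (hDstar : Measurable Dstar) (hD01 : ∀ ω, Dstar ω = 0 ∨ Dstar ω = 1)
    (Y0 Y1 : Ω → ℝ) (hY0 : Measurable Y0) (hY1 : Measurable Y1)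
    (yL yU : ℝ) (hy : yL ≤ yU)
    (hbd0 : ∀ ω, Y0 ω ∈ Set.Icc yL yU) (hbd1 : ∀ ω, Y1 ω ∈ Set.Icc yL yU)
    -- Assumption 1 (i) for the new policy
    (hA10 : P[Y0 | MeasurableSpace.comap (fun ω => (Dstar ω, Zstar ω, V ω)) inferInstance]
        =ᵐ[P] P[Y0 | MeasurableSpace.comap (fun ω => (x (Zstar ω), V ω)) inferInstance])
    (hA11 : P[Y1 | MeasurableSpace.comap (fun ω => (Dstar ω, Zstar ω, V ω)) inferInstance]
        =ᵐ[P] P[Y1 | MeasurableSpace.comap (fun ω => (x (Zstar ω), V ω)) inferInstance])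
    -- Assumption 1 (ii) for the new policy
    (hVZ : IndepFun V Zstar P)
    (hVunif : Measure.map V P = volume.restrict (Set.Icc (0 : Fin K → ℝ) 1))
    -- the marginal treatment response functions and the propensity score
    (m0 m1 : (Fin K → ℝ) → 𝓧 → ℝ) (mD : (Fin K → ℝ) → 𝓩 → ℝ)
    (hm0 : Measurable (Function.uncurry m0))
    (hm1 : Measurable (Function.uncurry m1))
    (hmD : Measurable (Function.uncurry mD))
    (hm0v : P[Y0 | MeasurableSpace.comap (fun ω => (V ω, x (Zstar ω))) inferInstance]
        =ᵐ[P] fun ω => m0 (V ω) (x (Zstar ω)))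
    (hm1v : P[Y1 | MeasurableSpace.comap (fun ω => (V ω, x (Zstar ω))) inferInstance]
        =ᵐ[P] fun ω => m1 (V ω) (x (Zstar ω)))
    (hmDv : P[Dstar | MeasurableSpace.comap (fun ω => (V ω, Zstar ω)) inferInstance]
        =ᵐ[P] fun ω => mD (V ω) (Zstar ω)) :
    (∫ ω, (Dstar ω * Y1 ω + (1 - Dstar ω) * Y0 ω) ∂P)
      = ∫ z, ∫ v in Set.Icc (0 : Fin K → ℝ) 1,
          (m0 v (x z) * (1 - mD v z) + m1 v (x z) * mD v z) ∂volume
          ∂(Measure.map Zstar P) := by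
  have hle₁ : MeasurableSpace.comap (fun ω => (Dstar ω, Zstar ω, V ω)) inferInstance
      ≤ (inferInstance : MeasurableSpace Ω) :=
    (hDstar.prodMk (hZstar.prodMk hV)).comap_le
  have hle₂₁ : MeasurableSpace.comap (fun ω => (V ω, Zstar ω)) inferInstance
      ≤ MeasurableSpace.comap (fun ω => (Dstar ω, Zstar ω, V ω)) inferInstance := by
    have hg : Measurable fun p : ℝ × 𝓩 × (Fin K → ℝ) => (p.2.2, p.2.1) := by fun_prop
    exact (hg.comp (comap_measurable fun ω => (Dstar ω, Zstar ω, V ω))).comap_le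
  have hswap : MeasurableSpace.comap (fun ω => (x (Zstar ω), V ω)) inferInstance
      = MeasurableSpace.comap (fun ω => (V ω, x (Zstar ω))) inferInstance :=
    le_antisymm
      (measurable_swap.comp (comap_measurable fun ω => (V ω, x (Zstar ω)))).comap_le
      (measurable_swap.comp (comap_measurable fun ω => (x (Zstar ω), V ω))).comap_le
  rw [hswap] at hA10 hA11
  have hDmeas : StronglyMeasurable[MeasurableSpace.comap
      (fun ω => (Dstar ω, Zstar ω, V ω)) inferInstance] Dstar :=
    (measurable_fst.comp
      (comap_measurable fun ω => (Dstar ω, Zstar ω, V ω))).stronglyMeasurable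
  have hm_meas (m : (Fin K → ℝ) → 𝓧 → ℝ) (hm : Measurable (Function.uncurry m)) :
      StronglyMeasurable[MeasurableSpace.comap (fun ω => (V ω, Zstar ω)) inferInstance]
        fun ω => m (V ω) (x (Zstar ω)) := by
    have hg : Measurable fun p : (Fin K → ℝ) × 𝓩 => m p.1 (x p.2) :=
      hm.comp (measurable_fst.prodMk (hx.comp measurable_snd))
    exact (hg.comp (comap_measurable fun ω => (V ω, Zstar ω))).stronglyMeasurable
  have hDbound (ω : Ω) : ‖Dstar ω‖ ≤ 1 := by
    rcases hD01 ω with h | h <;> simp [h]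
  have hDbound' (ω : Ω) : ‖((fun _ => (1 : ℝ)) - Dstar : Ω → ℝ) ω‖ ≤ 1 := by
    rcases hD01 ω with h | h <;> simp [h]
  have hDint : Integrable Dstar P :=
    Integrable.of_bound hDstar.aestronglyMeasurable 1 (ae_of_all _ hDbound)
  have hY0int : Integrable Y0 P := Integrable.of_mem_Icc yL yU hY0.aemeasurable (ae_of_all _ hbd0)
  have hY1int : Integrable Y1 P := Integrable.of_mem_Icc yL yU hY1.aemeasurable (ae_of_all _ hbd1)
  have hmDv' : P[(fun _ => (1 : ℝ)) - Dstar |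
      MeasurableSpace.comap (fun ω => (V ω, Zstar ω)) inferInstance]
      =ᵐ[P] fun ω => 1 - mD (V ω) (Zstar ω) := by
    filter_upwards [condExp_sub (integrable_const (1 : ℝ)) hDint
      (MeasurableSpace.comap (fun ω => (V ω, Zstar ω)) inferInstance), hmDv] with ω h h'
    rw [h, Pi.sub_apply, h', condExp_const (hle₂₁.trans hle₁)]
  obtain ⟨hi₁, he₁⟩ := integrable_mul_and_integral_mul_eq_of_condExp hle₂₁ hle₁ hDmeas hDbound
    hY1int (hm_meas m1 hm1) (hA11.trans hm1v) hmDv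
  obtain ⟨hi₀, he₀⟩ := integrable_mul_and_integral_mul_eq_of_condExp hle₂₁ hle₁
    (stronglyMeasurable_const.sub hDmeas) hDbound' hY0int (hm_meas m0 hm0)
    (hA10.trans hm0v) hmDv'
  have hDY1 : Integrable (fun ω => Dstar ω * Y1 ω) P :=
    hY1int.bdd_mul hDstar.aestronglyMeasurable (ae_of_all _ hDbound)
  have hDY0 : Integrable (fun ω => (1 - Dstar ω) * Y0 ω) P :=
    hY0int.bdd_mul (measurable_const.sub hDstar).aestronglyMeasurable (ae_of_all _ hDbound')
  have hF : Measurable fun p : (Fin K → ℝ) × 𝓩 =>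
      m0 p.1 (x p.2) * (1 - mD p.1 p.2) + m1 p.1 (x p.2) * mD p.1 p.2 := by
    have hp : Measurable fun p : (Fin K → ℝ) × 𝓩 => (p.1, x p.2) :=
      measurable_fst.prodMk (hx.comp measurable_snd)
    exact ((hm0.comp hp).mul (measurable_const.sub hmD)).add ((hm1.comp hp).mul hmD)
  rw [← hVunif, ← integral_comp_eq_integral_integral_of_indepFun hV hZstar hVZ hF (hi₀.add hi₁),
    integral_add hDY1 hDY0]
  exact (congrArg₂ (· + ·) he₁ he₀).trans ((add_comm _ _).trans (integral_add hi₀ hi₁).symm)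
end
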